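/- arXiv:1507.01072 — 4 statements merged into one kernel-verified Lean document; each statement's English description precedes it below -/
import Mathlib

section
/- Let M be a unital C*-algebra with a faithful tracial state τ, let n ≥ 2, let v₁, …, v_{n−1} ∈ M be freely independent Haar unitaries with respect to τ, and let α₀, α₁, …, α_{n−1} ∈ ℂ with Σ_{i=0}^{n−1} |αᵢ|² = 1. Then ‖α₀·1 + Σ_{i=1}^{n−1} αᵢ vᵢ‖ ≤ 2√(1 − 1/n). -/
open scoped BigOperators ComplexOrder

section Defs

variable {A : Type*} [Ring A] [StarRing A] [Algebra ℂ A]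

/-- `τ` is a (ℂ-linear) tracial state on the unital star ℂ-algebra `A`. -/
def IsTracialState (τ : A → ℂ) : Prop :=
  (∀ (c : ℂ) (x y : A), τ (c • x + y) = c * τ x + τ y) ∧
  τ 1 = 1 ∧ (∀ x : A, 0 ≤ τ (star x * x)) ∧ (∀ x y : A, τ (x * y) = τ (y * x))

/-- `τ` is faithful. -/
def IsFaithful (τ : A → ℂ) : Prop := ∀ x : A, τ (star x * x) = 0 → x = 0

def IsProjection (p : A) : Prop := star p = p ∧ p * p = p

def IsUnitary (u : A) : Prop := star u * u = 1 ∧ u * star u = 1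

/-- The alternating word `x_{i 0} (x_{i 1})* x_{i 2} (x_{i 3})* ⋯`. -/
def LWord {n m : ℕ} (x : Fin n → A) (i : Fin m → Fin n) : A :=
  (List.ofFn fun s : Fin m => if (s : ℕ) % 2 = 0 then x (i s) else star (x (i s))).prod

/-- The alternating word `(x_{i 0})* x_{i 1} (x_{i 2})* x_{i 3} ⋯`. -/
def LWordStar {n m : ℕ} (x : Fin n → A) (i : Fin m → Fin n) : A :=
  (List.ofFn fun s : Fin m => if (s : ℕ) % 2 = 0 then star (x (i s)) else x (i s)).prod

/-- L-freeness of a finite family with respect to `τ`. -/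
def IsLFree {n : ℕ} (τ : A → ℂ) (x : Fin n → A) : Prop :=
  ∀ (k : ℕ), 1 ≤ k → ∀ i : Fin (2 * k) → Fin n,
    (∀ s t : Fin (2 * k), (t : ℕ) = (s : ℕ) + 1 → i s ≠ i t) →
    τ (LWord x i) = 0 ∧ τ (LWordStar x i) = 0

/-- Integer powers of a unitary: negative powers are powers of the adjoint. -/
def zpowU (u : A) (k : ℤ) : A := if 0 ≤ k then u ^ k.toNat else star u ^ (-k).toNat

/-- `v₁, …, v_m` are freely independent Haar unitaries with respect to `τ`. -/
def AreHaarFree {m : ℕ} (τ : A → ℂ) (v : Fin m → A) : Prop :=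
  ∀ (r : ℕ), 1 ≤ r → ∀ (i : Fin r → Fin m) (e : Fin r → ℤ),
    (∀ s, e s ≠ 0) → (∀ s t : Fin r, (t : ℕ) = (s : ℕ) + 1 → i s ≠ i t) →
    τ ((List.ofFn fun s : Fin r => zpowU (v (i s)) (e s)).prod) = 0

/-- `X` and `Y` are freely independent sets with respect to `τ`: every alternating
word with letters from `X` and `Y` has zero trace. -/
def FreeSets (τ : A → ℂ) (X Y : Set A) : Prop :=
  ∀ (m : ℕ), 1 ≤ m → ∀ z : Fin m → A,
    ((∀ s : Fin m, if (s : ℕ) % 2 = 0 then z s ∈ X else z s ∈ Y) ∨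
     (∀ s : Fin m, if (s : ℕ) % 2 = 0 then z s ∈ Y else z s ∈ X)) →
    τ ((List.ofFn z).prod) = 0

end Defs


namespace AO

lemma tau_cfc_nonneg {M : Type*} [CStarAlgebra M] (τ : M → ℂ) (hτ : IsTracialState τ) (b : M)
    (hb : IsSelfAdjoint b) (g : ℝ → ℝ) (hg : Continuous g) (h0 : ∀ t ∈ spectrum ℝ b, 0 ≤ g t) :
    0 ≤ τ (cfc g b) := by
  have h : cfc g b = star (cfc (fun t => Real.sqrt (g t)) b) * (cfc (fun t => Real.sqrt (g t)) b) := by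
    have hs : IsSelfAdjoint (cfc (fun t => Real.sqrt (g t)) b) := cfc_predicate _ _
    rw [hs.star_eq, ← cfc_mul _ _ b (by fun_prop) (by fun_prop)]
    apply cfc_congr
    intro t ht
    exact (Real.mul_self_sqrt (h0 t ht)).symm
  rw [h]
  exact hτ.2.2.1 _

lemma norm_le_of_moments {M : Type*} [CStarAlgebra M] (τ : M → ℂ) (hτ : IsTracialState τ)
    (hf : IsFaithful τ) (a : M) (C : ℝ) (hC : 0 < C)
    (hm : ∀ k : ℕ, (τ ((star a * a) ^ k)).re ≤ (C ^ 2) ^ k) : ‖a‖ ≤ C := by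
  by_contra hlt
  push Not at hlt
  set b := star a * a with hbdef
  have hb : IsSelfAdjoint b := IsSelfAdjoint.star_mul_self a
  have hnb : ‖b‖ = ‖a‖ ^ 2 := by rw [hbdef, CStarRing.norm_star_mul_self, sq]
  have hCb : C ^ 2 < ‖b‖ := by rw [hnb]; gcongr
  obtain ⟨D, hD1, hD2⟩ := exists_between hCb
  have hC2 : 0 < C ^ 2 := by positivity
  have hD0 : 0 < D := hC2.trans hD1
  have hnt : Nontrivial M := by
    by_contra h
    rw [not_nontrivial_iff_subsingleton] at h
    have : b = 0 := Subsingleton.elim _ _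
    rw [this, norm_zero] at hCb
    linarith
  have hsp0 : ∀ t ∈ spectrum ℝ b, 0 ≤ t := fun t ht => spectrum_star_mul_self_nonneg t ht
  have hsp1 : ∀ t ∈ spectrum ℝ b, t ≤ ‖b‖ := fun t ht =>
    (le_abs_self t).trans (spectrum.norm_le_norm_of_mem ht)
  let f : ℝ → ℝ := fun t => max (t - D) 0
  have hfc : Continuous f := by fun_prop
  have hF : cfc f b ≠ 0 := by
    intro h0
    have h1 : ∀ t ∈ spectrum ℝ b, t ≤ D := by
      intro t ht
      have h2 : cfc f b = cfc (fun _ : ℝ => (0:ℝ)) b := by rw [h0]; simp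
      have := eqOn_of_cfc_eq_cfc h2 (by fun_prop) (by fun_prop) hb ht
      have h3 : max (t - D) 0 = 0 := this
      have := max_eq_right_iff.1 h3
      linarith
    have h4 : ‖cfc (id : ℝ → ℝ) b‖ ≤ D := by
      refine norm_cfc_le hD0.le ?_
      intro t ht
      simp only [id, Real.norm_eq_abs]
      rw [abs_of_nonneg (hsp0 t ht)]
      exact h1 t ht
    rw [cfc_id ℝ b] at h4
    linarith
  have hfsa : IsSelfAdjoint (cfc f b) := cfc_predicate _ _
  have hfsq : star (cfc f b) * cfc f b = cfc (fun t => f t * f t) b := by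
    rw [hfsa.star_eq, ← cfc_mul _ _ b (by fun_prop) (by fun_prop)]
  have hpos : 0 ≤ τ (cfc (fun t => f t * f t) b) := by rw [← hfsq]; exact hτ.2.2.1 _
  have hne : τ (cfc (fun t => f t * f t) b) ≠ 0 := by
    rw [← hfsq]; exact fun h => hF (hf _ h)
  have hε : 0 < (τ (cfc (fun t => f t * f t) b)).re := by
    have := lt_of_le_of_ne hpos hne.symm
    exact (Complex.lt_def.1 this).1
  set ε := (τ (cfc (fun t => f t * f t) b)).re
  have hlam : 0 < ‖b‖ := hC2.trans hCb
  have key : ∀ k : ℕ, D ^ k / ‖b‖ ^ 2 * ε ≤ (C ^ 2) ^ k := by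
    intro k
    have h1 := tau_cfc_nonneg τ hτ b hb (fun t => t ^ k - D ^ k / ‖b‖ ^ 2 * (f t * f t)) (by fun_prop) (by
      intro t ht
      have ht0 := hsp0 t ht
      have ht1 := hsp1 t ht
      have hk : 0 ≤ t ^ k := by positivity
      rcases le_total t D with h | h
      · have : f t = 0 := max_eq_right (by linarith)
        rw [this]; simpa
      · have : f t = t - D := max_eq_left (by linarith)
        rw [this, sub_nonneg]
        have h5 : (t - D) * (t - D) ≤ ‖b‖ ^ 2 := by nlinarith
        have h6 : D ^ k ≤ t ^ k := by gcongr
        calc D ^ k / ‖b‖ ^ 2 * ((t - D) * (t - D)) ≤ D ^ k / ‖b‖ ^ 2 * ‖b‖ ^ 2 := by gcongr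
          _ = D ^ k := by field_simp
          _ ≤ t ^ k := h6)
    have h2 : cfc (fun t => t ^ k - D ^ k / ‖b‖ ^ 2 * (f t * f t)) b
        = ((-(D ^ k / ‖b‖ ^ 2) : ℝ) : ℂ) • cfc (fun t => f t * f t) b + b ^ k := by
      rw [cfc_sub _ _ b (by fun_prop) (by fun_prop), cfc_const_mul _ _ b (by fun_prop), cfc_pow_id b k]
      rw [Complex.coe_smul, neg_smul]; abel
    rw [h2, hτ.1] at h1
    have h3 := (Complex.le_def.1 h1).1
    rw [Complex.add_re, Complex.re_ofReal_mul] at h3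
    have h4 := hm k
    simp only [Complex.zero_re] at h3
    linarith
  have hr : C ^ 2 / D < 1 := (div_lt_one hD0).2 hD1
  obtain ⟨k, hk⟩ := exists_pow_lt_of_lt_one (show 0 < ε / ‖b‖ ^ 2 by positivity) hr
  have := key k
  rw [div_pow, div_lt_iff₀ (by positivity)] at hk
  have e : D ^ k / ‖b‖ ^ 2 * ε = ε / ‖b‖ ^ 2 * D ^ k := by ring
  linarith
end AO
namespace AO

lemma schur {G ι : Type*} [Group G] [Fintype ι] [DecidableEq G] [DecidableEq ι] (γ : ι → G)
    (α : ι → ℝ) (hα0 : ∀ c, 0 ≤ α c)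
    (p q : G → ι) (hpq : ∀ h c, p h = c ∨ q (γ c * h) = c) (x C : ℝ) (hx : 0 ≤ x)
    (hC : ∑ c, (Real.sqrt (x ^ 2 + α c ^ 2) - x) + 2 * x ≤ C)
    (S : Finset G) (ξ η : G → ℝ) :
    ∑ c, ∑ h ∈ S, ∑ g ∈ S, (if g = γ c * h then α c * ξ h * η g else 0) ≤
      C / 2 * (∑ h ∈ S, ξ h ^ 2 + ∑ g ∈ S, η g ^ 2) := by
  set s : ι → ℝ := fun c => Real.sqrt (x ^ 2 + α c ^ 2) with hs
  have hs2 : ∀ c, s c ^ 2 = x ^ 2 + α c ^ 2 := fun c => Real.sq_sqrt (by positivity)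
  have hsx : ∀ c, x ≤ s c := fun c => Real.le_sqrt_of_sq_le (by nlinarith [sq_nonneg (α c)])
  let w : (G → ι) → ι → G → ℝ := fun r c h => s c - x + if r h = c then 2 * x else 0
  have hw0 : ∀ r c h, 0 ≤ w r c h := by
    intro r c h
    have := hsx c
    simp only [w]; split_ifs <;> linarith
  have hw : ∀ r h, ∑ c, w r c h ≤ C := by
    intro r h
    simp only [w, Finset.sum_add_distrib, Finset.sum_ite_eq, Finset.mem_univ, if_true]
    exact hC
  have edge : ∀ c h g, g = γ c * h →
      α c * ξ h * η g ≤ w p c h * ξ h ^ 2 / 2 + w q c g * η g ^ 2 / 2 := by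
    intro c h g hg
    have hprod : α c ^ 2 ≤ w p c h * w q c g := by
      have h1 := hs2 c
      have h2 := hsx c
      have h3 : p h = c ∨ q g = c := by rw [hg]; exact hpq h c
      simp only [w]
      split_ifs with ha hb hb
      · nlinarith
      · nlinarith
      · nlinarith
      · tauto
    have hA := hw0 p c h
    have hB := hw0 q c g
    have e1 : α c ≤ Real.sqrt (w p c h) * Real.sqrt (w q c g) := by
      rw [← Real.sqrt_mul hA]; exact Real.le_sqrt_of_sq_le hprod
    have e2 : α c * ξ h * η g ≤ α c * (|ξ h| * |η g|) := by
      rw [mul_assoc, ← abs_mul]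
      exact mul_le_mul_of_nonneg_left (le_abs_self _) (hα0 c)
    have e3 : α c * (|ξ h| * |η g|) ≤
        Real.sqrt (w p c h) * Real.sqrt (w q c g) * (|ξ h| * |η g|) := by gcongr
    have e4 := two_mul_le_add_sq (Real.sqrt (w p c h) * |ξ h|) (Real.sqrt (w q c g) * |η g|)
    rw [mul_pow, mul_pow, Real.sq_sqrt hA, Real.sq_sqrt hB, sq_abs, sq_abs] at e4
    linarith
  calc ∑ c, ∑ h ∈ S, ∑ g ∈ S, (if g = γ c * h then α c * ξ h * η g else 0)
      ≤ ∑ c, ∑ h ∈ S, ∑ g ∈ S, ((if g = γ c * h then w p c h * ξ h ^ 2 / 2 else 0)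
          + (if h = (γ c)⁻¹ * g then w q c g * η g ^ 2 / 2 else 0)) := by
        refine Finset.sum_le_sum fun c _ => Finset.sum_le_sum fun h _ =>
          Finset.sum_le_sum fun g _ => ?_
        by_cases hg : g = γ c * h
        · have : h = (γ c)⁻¹ * g := by rw [hg]; group
          rw [if_pos hg, if_pos hg, if_pos this]; exact edge c h g hg
        · have : ¬ h = (γ c)⁻¹ * g := fun e => hg (by rw [e]; group)
          rw [if_neg hg, if_neg hg, if_neg this]; simp
    _ = ∑ c, ∑ h ∈ S, ∑ g ∈ S, (if g = γ c * h then w p c h * ξ h ^ 2 / 2 else 0)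
        + ∑ c, ∑ g ∈ S, ∑ h ∈ S, (if h = (γ c)⁻¹ * g then w q c g * η g ^ 2 / 2 else 0) := by
        simp only [Finset.sum_add_distrib]
        congr 1
        exact Finset.sum_congr rfl fun c _ => Finset.sum_comm
    _ ≤ ∑ c, ∑ h ∈ S, w p c h * ξ h ^ 2 / 2 + ∑ c, ∑ g ∈ S, w q c g * η g ^ 2 / 2 := by
        refine add_le_add ?_ ?_ <;>
        · refine Finset.sum_le_sum fun c _ => Finset.sum_le_sum fun h _ => ?_
          rw [Finset.sum_ite_eq']
          have h1 := hw0 p c h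
          have h2 := hw0 q c h
          split_ifs
          · exact le_rfl
          · positivity
    _ = ∑ h ∈ S, (∑ c, w p c h) * (ξ h ^ 2 / 2) + ∑ g ∈ S, (∑ c, w q c g) * (η g ^ 2 / 2) := by
        rw [Finset.sum_comm]
        congr 1
        · simp only [Finset.sum_mul, mul_div_assoc]
        · rw [Finset.sum_comm]; simp only [Finset.sum_mul, mul_div_assoc]
    _ ≤ ∑ h ∈ S, C * (ξ h ^ 2 / 2) + ∑ g ∈ S, C * (η g ^ 2 / 2) := by
        refine add_le_add ?_ ?_ <;>
        · refine Finset.sum_le_sum fun h _ => ?_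
          exact mul_le_mul_of_nonneg_right (hw _ _) (by positivity)
    _ = _ := by
        rw [mul_add, Finset.mul_sum, Finset.mul_sum]
        congr 1 <;> exact Finset.sum_congr rfl fun _ _ => by ring

lemma trace_sq {M G : Type*} [Ring M] [StarRing M] [Algebra ℂ M] [StarModule ℂ M] [Group G]
    [DecidableEq G]
    (T : M →ₗ[ℂ] ℂ) (u : G →* M) (hu : ∀ g, star (u g) = u g⁻¹)
    (hT : ∀ g, T (u g) = if g = 1 then 1 else 0) (S : Finset G) (ξ : G → ℂ) :
    T (star (∑ h ∈ S, ξ h • u h) * (∑ h ∈ S, ξ h • u h)) = ((∑ h ∈ S, ‖ξ h‖ ^ 2 : ℝ) : ℂ) := by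
  simp only [star_sum, star_smul, hu, Finset.sum_mul, Finset.mul_sum, map_sum, smul_mul_assoc,
    mul_smul_comm, ← map_mul, map_smul, hT, smul_eq_mul, mul_ite, mul_one, mul_zero,
    inv_mul_eq_one]
  push_cast
  refine Finset.sum_congr rfl fun h hh => ?_
  simp [hh, Complex.mul_conj']

lemma bilin {M G ι : Type*} [Ring M] [StarRing M] [Algebra ℂ M] [StarModule ℂ M] [Group G]
    [Fintype ι] [DecidableEq G] [DecidableEq ι]
    (T : M →ₗ[ℂ] ℂ) (u : G →* M) (hu : ∀ g, star (u g) = u g⁻¹)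
    (hT : ∀ g, T (u g) = if g = 1 then 1 else 0)
    (γ : ι → G) (α : ι → ℂ)
    (p q : G → ι) (hpq : ∀ h c, p h = c ∨ q (γ c * h) = c) (x C : ℝ) (hx : 0 ≤ x)
    (hC : ∑ c, (Real.sqrt (x ^ 2 + ‖α c‖ ^ 2) - x) + 2 * x ≤ C)
    (X Y : M) (hX : X ∈ (MonoidAlgebra.lift ℂ M G u).range)
    (hY : Y ∈ (MonoidAlgebra.lift ℂ M G u).range) :
    (T (star Y * ((∑ c, α c • u (γ c)) * X))).re ≤
      C / 2 * ((T (star X * X)).re + (T (star Y * Y)).re) := by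
  obtain ⟨ξ, rfl⟩ := hX
  obtain ⟨η, rfl⟩ := hY
  set S := ξ.coeff.support ∪ η.coeff.support with hS
  have e1 : MonoidAlgebra.lift ℂ M G u ξ = ∑ h ∈ S, ξ.coeff h • u h := by
    rw [MonoidAlgebra.lift_apply]
    exact Finsupp.sum_of_support_subset _ Finset.subset_union_left _ (by simp)
  have e2 : MonoidAlgebra.lift ℂ M G u η = ∑ h ∈ S, η.coeff h • u h := by
    rw [MonoidAlgebra.lift_apply]
    exact Finsupp.sum_of_support_subset _ Finset.subset_union_right _ (by simp)
  change (T (star (MonoidAlgebra.lift ℂ M G u η) * (_ * MonoidAlgebra.lift ℂ M G u ξ))).re ≤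
    C / 2 * ((T (star (MonoidAlgebra.lift ℂ M G u ξ) * MonoidAlgebra.lift ℂ M G u ξ)).re +
      (T (star (MonoidAlgebra.lift ℂ M G u η) * MonoidAlgebra.lift ℂ M G u η)).re)
  rw [e1, e2, trace_sq T u hu hT, trace_sq T u hu hT, Complex.ofReal_re, Complex.ofReal_re]
  refine le_trans ?_ (schur γ (fun c => ‖α c‖) (fun c => norm_nonneg _) p q hpq x C hx hC S
    (fun h => ‖ξ.coeff h‖) (fun h => ‖η.coeff h‖))
  have e3 : T (star (∑ h ∈ S, η.coeff h • u h) * ((∑ c, α c • u (γ c)) * ∑ h ∈ S, ξ.coeff h • u h))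
      = ∑ c, ∑ h ∈ S, ∑ g ∈ S,
        (if g = γ c * h then star (η.coeff g) * (α c * ξ.coeff h) else 0) := by
    simp only [Finset.sum_mul, Finset.mul_sum, star_sum, star_smul, hu, map_sum, smul_mul_assoc,
      mul_smul_comm, ← map_mul, map_smul, hT, smul_eq_mul, mul_ite, mul_one, mul_zero,
      inv_mul_eq_one]
    rw [Finset.sum_comm]
    refine Finset.sum_congr rfl fun c _ => Finset.sum_congr rfl fun h _ =>
      Finset.sum_congr rfl fun g _ => ?_
    split_ifs
    · ring
    · rfl
  rw [e3]
  refine (Complex.re_le_norm _).trans ?_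
  refine (norm_sum_le _ _).trans (Finset.sum_le_sum fun c _ => ?_)
  refine (norm_sum_le _ _).trans (Finset.sum_le_sum fun h _ => ?_)
  refine (norm_sum_le _ _).trans (Finset.sum_le_sum fun g _ => ?_)
  split_ifs
  · rw [norm_mul, norm_mul, norm_star]; linarith
  · simp

end AO
namespace AO

def pcol {m : ℕ} (g : FreeGroup (Fin m)) : Option (Fin m) :=
  match g.toWord.head? with
  | some (i, false) => some i
  | _ => none

def qcol {m : ℕ} (g : FreeGroup (Fin m)) : Option (Fin m) :=
  match g.toWord.head? with
  | some (i, true) => some i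
  | _ => none

def gen {m : ℕ} (c : Option (Fin m)) : FreeGroup (Fin m) :=
  match c with
  | none => 1
  | some i => FreeGroup.of i

lemma pq {m : ℕ} (h : FreeGroup (Fin m)) (c : Option (Fin m)) :
    pcol h = c ∨ qcol (gen c * h) = c := by
  cases c with
  | none =>
    simp only [gen, one_mul, pcol, qcol]
    rcases h.toWord.head? with _ | ⟨i, _ | _⟩ <;> simp
  | some i =>
    by_cases hh : h ∈ FreeGroup.startsWith (i, false)
    · left
      have h1 : h.toWord[0]? = some (i, false) := hh
      rw [← List.head?_eq_getElem?] at h1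
      simp [pcol, h1]
    · right
      have h1 : (FreeGroup.mk [(i, true)] * h).toWord[0]? = some (i, true) :=
        FreeGroup.startsWith_mk_mul (w := (i, true)) h hh
      rw [← List.head?_eq_getElem?] at h1
      have h2 : gen (some i) * h = FreeGroup.mk [(i, true)] * h := rfl
      rw [h2, qcol, h1]

lemma syll {m : ℕ} {H : Type*} [Group H] (f : Fin m → H) :
    ∀ (a : Fin m × Bool) (L : List (Fin m × Bool)), FreeGroup.IsReduced (a :: L) →
    ∃ (k : ℤ) (K : List (Fin m × ℤ)),
      (if a.2 then 0 < k else k < 0) ∧ (∀ z ∈ (a.1, k) :: K, z.2 ≠ 0) ∧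
      List.IsChain (fun y z : Fin m × ℤ => y.1 ≠ z.1) ((a.1, k) :: K) ∧
      (((a.1, k) :: K).map fun z => f z.1 ^ z.2).prod =
        ((a :: L).map fun x => bif x.2 then f x.1 else (f x.1)⁻¹).prod := by
  intro a L
  induction L generalizing a with
  | nil =>
    intro _
    obtain ⟨i, b⟩ := a
    refine ⟨if b then 1 else -1, [], ?_, ?_, ?_, ?_⟩
    · cases b <;> simp
    · cases b <;> simp
    · simp
    · cases b <;> simp
  | cons b L ih =>
    intro hr
    rw [FreeGroup.isReduced_cons_cons] at hr
    obtain ⟨k, K, h1, h2, h3, h4⟩ := ih b hr.2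
    obtain ⟨i, e⟩ := a
    obtain ⟨j, e'⟩ := b
    by_cases hij : i = j
    · obtain rfl : e = e' := hr.1 hij
      subst hij
      refine ⟨k + if e then 1 else -1, K, ?_, ?_, ?_, ?_⟩
      · cases e <;> simp at h1 ⊢ <;> omega
      · intro z hz
        rcases List.mem_cons.1 hz with rfl | hz
        · cases e <;> simp at h1 ⊢ <;> omega
        · exact h2 z (List.mem_cons_of_mem _ hz)
      · cases K with
        | nil => simp
        | cons y K =>
          rw [List.isChain_cons_cons] at h3 ⊢
          exact h3
      · conv_rhs => rw [List.map_cons, List.prod_cons, ← h4]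
        rw [List.map_cons, List.prod_cons, List.map_cons, List.prod_cons, ← mul_assoc]
        congr 1
        cases e
        · change f i ^ (k + -1) = (f i)⁻¹ * f i ^ k
          rw [add_comm k, zpow_add, zpow_neg_one]
        · simp [add_comm k, zpow_add]
    · refine ⟨if e then 1 else -1, (j, k) :: K, ?_, ?_, ?_, ?_⟩
      · cases e <;> simp
      · intro z hz
        rcases List.mem_cons.1 hz with rfl | hz
        · cases e <;> simp
        · exact h2 z hz
      · rw [List.isChain_cons_cons]; exact ⟨hij, h3⟩
      · rw [List.map_cons, List.prod_cons, h4]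
        conv_rhs => rw [List.map_cons, List.prod_cons]
        congr 1
        cases e <;> simp

lemma trace_word {M : Type*} [Ring M] [StarRing M] [Algebra ℂ M] (τ : M → ℂ) {m : ℕ}
    (v : Fin m → M) (U : Fin m → unitary M) (hU : ∀ i, (U i : M) = v i)
    (hfree : AreHaarFree τ v) (g : FreeGroup (Fin m)) (hg : g ≠ 1) :
    τ ((FreeGroup.lift U g : unitary M) : M) = 0 := by
  rw [← FreeGroup.mk_toWord (x := g), FreeGroup.lift_mk]
  have hr := FreeGroup.isReduced_toWord (x := g)
  have hne : g.toWord ≠ [] := fun h => hg (FreeGroup.toWord_eq_nil_iff.1 h)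
  generalize g.toWord = L at hr hne
  cases L with
  | nil => exact absurd rfl hne
  | cons a L =>
    obtain ⟨k, K, -, h2, h3, h4⟩ := syll U a L hr
    rw [← h4]
    generalize hK : (a.1, k) :: K = K' at h2 h3
    have hz : ∀ i (k : ℤ), ((U i ^ k : unitary M) : M) = zpowU (v i) k := by
      intro i k
      unfold zpowU
      split_ifs with hk
      · obtain ⟨n, rfl⟩ := Int.eq_ofNat_of_zero_le hk
        simp [hU]
      · obtain ⟨n, hn⟩ := Int.eq_ofNat_of_zero_le (show 0 ≤ -k by omega)
        obtain rfl : k = -n := by omega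
        simp [hU, ← Unitary.star_eq_inv]
    have := hfree K'.length (by rw [← hK]; simp) (fun s => (K'.get s).1) (fun s => (K'.get s).2)
      (fun s => h2 _ (List.get_mem _ _)) (by
        intro s t hst
        have := List.isChain_iff_getElem.1 h3 s (by rw [← hst]; exact t.2)
        simpa [← hst] using this)
    rw [← this]
    congr 1
    have e : ((K'.map fun z => U z.1 ^ z.2).prod : M) =
        (K'.map fun z => ((U z.1 ^ z.2 : unitary M) : M)).prod := by
      have := map_list_prod (unitary M).subtype (K'.map fun z => U z.1 ^ z.2)
      rw [List.map_map] at this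
      exact this
    rw [e]
    congr 1
    simp only [hz]
    apply List.ext_getElem <;> simp
end AO
namespace AO

lemma arith (m : ℕ) (hm : 1 ≤ m) (β : Option (Fin m) → ℝ) (hβ : ∑ c, β c ^ 2 = 1) :
    ∃ x : ℝ, 0 ≤ x ∧ ∑ c, (Real.sqrt (x ^ 2 + β c ^ 2) - x) + 2 * x ≤
      2 * Real.sqrt (1 - 1 / ((m + 1 : ℕ) : ℝ)) := by
  set R := Real.sqrt (1 - 1 / ((m + 1 : ℕ) : ℝ)) with hR
  have hm' : (1 : ℝ) ≤ m := by exact_mod_cast hm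
  have h0 : (0 : ℝ) < 1 - 1 / ((m + 1 : ℕ) : ℝ) := by
    push_cast
    rw [sub_pos, div_lt_one (by linarith)]; linarith
  have hRpos : 0 < R := Real.sqrt_pos.2 h0
  have hR2 : R ^ 2 * (m + 1) = m := by
    rw [hR, Real.sq_sqrt h0.le]; push_cast; field_simp; ring
  have hK0 : 0 < 1 / (2 * R) := by positivity
  set K := 1 / (2 * R) with hK
  have hKR : K * R = 1 / 2 := by rw [hK]; field_simp
  have hK2 : K ^ 2 * (4 * m) = m + 1 := by
    have : K ^ 2 * R ^ 2 = 1 / 4 := by rw [← mul_pow, hKR]; norm_num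
    have h4 : K ^ 2 * (4 * m) = 4 * (K ^ 2 * R ^ 2) * (m + 1) := by
      linear_combination (-4 * K ^ 2) * hR2
    rw [h4, this]; ring
  obtain ⟨x, hxd⟩ : ∃ x : ℝ, x = (m - 1) / (m + 1) * K := ⟨_, rfl⟩
  have hx : x * (m + 1) = (m - 1) * K := by rw [hxd]; field_simp
  have hx0 : 0 ≤ x := by
    have : (0 : ℝ) ≤ m - 1 := by linarith
    rw [hxd]; positivity
  refine ⟨x, hx0, ?_⟩
  have hxK : x ^ 2 + 1 / (m + 1) = K ^ 2 := by
    rw [hxd]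
    have h5 : K ^ 2 = (m + 1) / (4 * m) := by rw [← hK2]; field_simp
    rw [mul_pow, h5]; field_simp; ring
  have hs : ∀ c, Real.sqrt (x ^ 2 + β c ^ 2) ≤ (x ^ 2 + β c ^ 2) * (1 / (2 * K)) + K / 2 := by
    intro c
    have h6 := Real.sq_sqrt (show 0 ≤ x ^ 2 + β c ^ 2 by positivity)
    set s := Real.sqrt (x ^ 2 + β c ^ 2)
    rw [← h6]
    have : s ^ 2 * (1 / (2 * K)) + K / 2 - s = (s - K) ^ 2 * (1 / (2 * K)) := by field_simp; ring
    have : 0 ≤ (s - K) ^ 2 * (1 / (2 * K)) := by positivity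
    linarith
  have hsum : ∑ c, (Real.sqrt (x ^ 2 + β c ^ 2) - x) ≤
      ∑ c, ((x ^ 2 + β c ^ 2) * (1 / (2 * K)) + K / 2 - x) :=
    Finset.sum_le_sum fun c _ => sub_le_sub_right (hs c) x
  have hcard : ((Finset.univ : Finset (Option (Fin m))).card : ℝ) = m + 1 := by simp
  rw [Finset.sum_sub_distrib, Finset.sum_sub_distrib, Finset.sum_add_distrib, ← Finset.sum_mul,
    Finset.sum_add_distrib, hβ] at hsum
  rw [Finset.sum_sub_distrib]
  simp only [Finset.sum_const, nsmul_eq_mul, hcard] at hsum ⊢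
  have e1 : ((m + 1) * x ^ 2 + 1) * (1 / (2 * K)) = (m + 1) * K / 2 := by
    have : (m + 1) * x ^ 2 + 1 = (m + 1) * K ^ 2 := by rw [← hxK]; field_simp
    rw [this]; field_simp
  rw [e1] at hsum
  have e2 : 2 * R = 4 * K * R ^ 2 := by
    have : 4 * K * R ^ 2 = 4 * (K * R) * R := by ring
    rw [this, hKR]; ring
  have e3 : (m + 1) * K - (m - 1) * x = 2 * R := by
    have hRR : R ^ 2 = m / (m + 1) := by rw [eq_div_iff (by positivity), hR2]
    rw [e2, hRR]; rw [hxd]; field_simp; ring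
  linarith

lemma moments {M : Type*} [Ring M] [StarRing M] [Algebra ℂ M] [StarModule ℂ M]
    (T : M →ₗ[ℂ] ℂ) (h1 : T 1 = 1) (a : M) (N : Subalgebra ℂ M) (ha : a ∈ N) (ha' : star a ∈ N)
    (C : ℝ) (hC : 0 < C)
    (H : ∀ X ∈ N, ∀ Y ∈ N, (T (star Y * (a * X))).re ≤
      C / 2 * ((T (star X * X)).re + (T (star Y * Y)).re)) (k : ℕ) :
    (T ((star a * a) ^ k)).re ≤ (C ^ 2) ^ k := by
  set b := star a * a with hb
  have hbN : b ∈ N := N.mul_mem ha' ha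
  have hbs : star b = b := by simp [hb]
  have hbp : ∀ j, star (b ^ j) = b ^ j := fun j => by rw [star_pow, hbs]
  have sc : ∀ (r : ℝ) (z : M), (T ((r : ℂ) • z)).re = r * (T z).re := by
    intro r z; rw [map_smul, smul_eq_mul, Complex.re_ofReal_mul]
  have sst : ∀ (r : ℝ) (z : M), star ((r : ℂ) • z) = (r : ℂ) • star z := by
    intro r z; rw [star_smul]; simp
  have step : ∀ k, (T (b ^ (k + 1))).re ≤ C ^ 2 * (T (b ^ k)).re := by
    intro k
    rcases Nat.even_or_odd' k with ⟨j, rfl | rfl⟩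
    · have h := H (b ^ j) (N.pow_mem hbN j) (((C⁻¹ : ℝ) : ℂ) • (a * b ^ j))
        (N.smul_mem (N.mul_mem ha (N.pow_mem hbN j)) _)
      have e1 : star (a * b ^ j) * (a * b ^ j) = b ^ (2 * j + 1) := by
        rw [star_mul, hbp, mul_assoc, ← mul_assoc (star a), ← hb, ← pow_succ', ← pow_add]
        congr 1; omega
      have e2 : b ^ j * b ^ j = b ^ (2 * j) := by rw [← pow_add]; congr 1; omega
      rw [sst, smul_mul_assoc, smul_mul_smul_comm, e1, hbp, e2, ← Complex.ofReal_mul, sc, sc] at h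
      set A := (T (b ^ (2 * j + 1))).re
      set B := (T (b ^ (2 * j))).re
      have h7 : C ^ 2 * B - A = 2 * C * (C / 2 * (B + C⁻¹ * C⁻¹ * A) - C⁻¹ * A) := by
        field_simp; ring
      have : 0 ≤ 2 * C * (C / 2 * (B + C⁻¹ * C⁻¹ * A) - C⁻¹ * A) :=
        mul_nonneg (by positivity) (by linarith)
      linarith
    · have h := H (((C⁻¹ : ℝ) : ℂ) • b ^ (j + 1)) (N.smul_mem (N.pow_mem hbN _) _) (a * b ^ j)
        (N.mul_mem ha (N.pow_mem hbN j))
      have e1 : star (a * b ^ j) * (a * b ^ j) = b ^ (2 * j + 1) := by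
        rw [star_mul, hbp, mul_assoc, ← mul_assoc (star a), ← hb, ← pow_succ', ← pow_add]
        congr 1; omega
      have e2 : star (a * b ^ j) * (a * b ^ (j + 1)) = b ^ (2 * j + 1 + 1) := by
        rw [star_mul, hbp, mul_assoc, ← mul_assoc (star a), ← hb, ← pow_succ', ← pow_add]
        congr 1; omega
      have e3 : b ^ (j + 1) * b ^ (j + 1) = b ^ (2 * j + 1 + 1) := by
        rw [← pow_add]; congr 1; omega
      rw [sst, mul_smul_comm, mul_smul_comm, smul_mul_smul_comm, e1, hbp, e2, e3,
        ← Complex.ofReal_mul, sc, sc] at h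
      set A := (T (b ^ (2 * j + 1 + 1))).re
      set B := (T (b ^ (2 * j + 1))).re
      have h7 : C ^ 2 * B - A = 2 * C * (C / 2 * (C⁻¹ * C⁻¹ * A + B) - C⁻¹ * A) := by
        field_simp; ring
      have : 0 ≤ 2 * C * (C / 2 * (C⁻¹ * C⁻¹ * A + B) - C⁻¹ * A) :=
        mul_nonneg (by positivity) (by linarith)
      linarith
  induction k with
  | zero => simp [h1]
  | succ k ih =>
    refine (step k).trans ?_
    rw [pow_succ' (C ^ 2)]
    exact mul_le_mul_of_nonneg_left ih (by positivity)

lemma main {M : Type*} [CStarAlgebra M]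
    (τ : M → ℂ) (hτ : IsTracialState τ) (hτf : IsFaithful τ)
    (m : ℕ) (hm : 1 ≤ m)
    (v : Fin m → M) (hv : ∀ i, IsUnitary (v i)) (hfree : AreHaarFree τ v)
    (α : Option (Fin m) → ℂ) (hα : ∑ c, ‖α c‖ ^ 2 = 1) :
    ‖α none • (1 : M) + ∑ i, α (some i) • v i‖ ≤ 2 * Real.sqrt (1 - 1 / ((m + 1 : ℕ) : ℝ)) := by
  have h00 : τ 0 = 0 := by
    have := hτ.1 1 0 0
    simpa using this
  let T : M →ₗ[ℂ] ℂ :=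
    { toFun := τ
      map_add' := fun x y => by simpa using hτ.1 1 x y
      map_smul' := fun c x => by simpa [h00] using hτ.1 c x 0 }
  let U : Fin m → unitary M := fun i => ⟨v i, Unitary.mem_iff.2 (hv i)⟩
  let u : FreeGroup (Fin m) →* M := (unitary M).subtype.comp (FreeGroup.lift U)
  have hu : ∀ g, star (u g) = u g⁻¹ := by
    intro g
    simp only [u, MonoidHom.comp_apply, map_inv]
    rfl
  have hT : ∀ g, T (u g) = if g = 1 then 1 else 0 := by
    intro g
    split_ifs with hg
    · rw [hg, map_one]; exact hτ.2.1
    · exact trace_word τ v U (fun _ => rfl) hfree g hg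
  obtain ⟨x, hx0, hx⟩ := arith m hm (fun c => ‖α c‖) hα
  set C := 2 * Real.sqrt (1 - 1 / ((m + 1 : ℕ) : ℝ)) with hCdef
  have hC : 0 < C := by
    have hm' : (1 : ℝ) ≤ m := by exact_mod_cast hm
    have h0 : (0 : ℝ) < 1 - 1 / ((m + 1 : ℕ) : ℝ) := by
      push_cast
      rw [sub_pos, div_lt_one (by linarith)]; linarith
    have := Real.sqrt_pos.2 h0
    positivity
  have ea : α none • (1 : M) + ∑ i, α (some i) • v i = ∑ c, α c • u (gen c) := by
    rw [Fintype.sum_option]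
    have g0 : u (gen none) = 1 := map_one u
    have g1 : ∀ i, u (gen (some i)) = v i := fun i => by simp [gen, u, U]
    simp only [g0, g1]
  rw [ea]
  have hmem : ∀ g, u g ∈ (MonoidAlgebra.lift ℂ M _ u).range := fun g =>
    ⟨MonoidAlgebra.of ℂ _ g, MonoidAlgebra.lift_of u g⟩
  refine norm_le_of_moments τ hτ hτf _ C hC fun k => ?_
  refine moments T hτ.2.1 _ (MonoidAlgebra.lift ℂ M _ u).range ?_ ?_ C hC ?_ k
  · exact Subalgebra.sum_mem _ fun c _ => Subalgebra.smul_mem _ (hmem _) _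
  · rw [star_sum]
    refine Subalgebra.sum_mem _ fun c _ => ?_
    rw [star_smul, hu]
    exact Subalgebra.smul_mem _ (hmem _) _
  · intro X hX Y hY
    exact bilin T u hu hT gen α pcol qcol pq x C hx0 hx X Y hX hY

end AO

/-- (Akemann–Ostrand) For freely independent Haar unitaries
`v₁, …, v_{n-1}` and scalars with `Σ_{i=0}^{n-1} |αᵢ|² = 1` one has
`‖α₀·1 + Σ_{i=1}^{n-1} αᵢ vᵢ‖ ≤ 2√(1 - 1/n)`. -/
theorem norm_comb_one_add_haar_unitaries
    {M : Type*} [NormedRing M] [StarRing M] [CStarRing M] [NormedAlgebra ℂ M]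
    [StarModule ℂ M] [CompleteSpace M]
    (τ : M → ℂ) (hτ : IsTracialState τ) (hτf : IsFaithful τ)
    (n : ℕ) (hn : 2 ≤ n)
    (v : Fin (n - 1) → M) (hv : ∀ i, IsUnitary (v i)) (hfree : AreHaarFree τ v)
    (α : Fin n → ℂ) (hα : ∑ i, ‖α i‖ ^ 2 = 1) :
    ‖α ⟨0, by omega⟩ • (1 : M) +
        ∑ i : Fin (n - 1), α (Fin.cast (by omega : n - 1 + 1 = n) i.succ) • v i‖ ≤
      2 * Real.sqrt (1 - 1 / (n : ℝ)) := by
  obtain ⟨m, rfl⟩ : ∃ m, n = m + 1 := ⟨n - 1, by omega⟩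
  let _ : CStarAlgebra M := { }
  have hα' : ∑ c : Option (Fin m), ‖(fun c : Option (Fin m) =>
      α (c.elim 0 Fin.succ)) c‖ ^ 2 = 1 := by
    rw [Fintype.sum_option, ← hα, Fin.sum_univ_succ]
    rfl
  exact AO.main τ hτ hτf m (by omega) v hv hfree _ hα'
end

section
/- Let M be a unital C*-algebra with a faithful tracial state τ and let p, q ∈ M be projections that are freely independent with respect to τ, with τ(q) ≤ τ(p) = 1/2. Set v = 2p − 1 (a self-adjoint unitary). Then ‖q v q‖ = 2√(τ(q)(1−τ(q))). -/
open scoped BigOperators ComplexOrder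

noncomputable section Aux

variable {M : Type*} [CStarAlgebra M]

/-- The alternating word `v b v b ⋯ b v` with `b = q - α`. -/
def fpV (q v : M) (α : ℝ) (n : ℕ) : M := (v * (q - α • (1 : M))) ^ n * v

/-- `Y 0 = q`, `Y (n+1) = q V_n q`. -/
def fpY (q v : M) (α : ℝ) : ℕ → M
  | 0 => q
  | (n + 1) => q * fpV q v α n * q

/-- Real-valued form of the hypotheses. -/
structure FpSetup (T : M →ₗ[ℝ] ℝ) (q v : M) (α : ℝ) : Prop where
  qs : star q = q
  qq : q * q = q
  vs : star v = v
  vv : v * v = 1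
  T1 : T 1 = 1
  pos : ∀ x : M, 0 ≤ T (star x * x)
  tr : ∀ x y : M, T (x * y) = T (y * x)
  faithful : ∀ x : M, T (star x * x) = 0 → x = 0
  Tq : T q = α
  TV : ∀ n, T (fpV q v α n) = 0
  TbV : ∀ n, T ((q - α • (1 : M)) * fpV q v α n) = 0

variable {T : M →ₗ[ℝ] ℝ} {q v : M} {α : ℝ}

lemma fpV_zero : fpV q v α 0 = v := by simp [fpV]

lemma fpV_succ (n : ℕ) : fpV q v α (n + 1) = v * (q - α • (1 : M)) * fpV q v α n := by
  simp only [fpV, pow_succ', mul_assoc]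

lemma fpV_add (m n : ℕ) : fpV q v α m * (q - α • (1 : M)) * fpV q v α n
    = fpV q v α (m + n + 1) := by
  induction m with
  | zero => rw [fpV_zero, zero_add, fpV_succ]
  | succ m ih =>
    rw [fpV_succ, show m + 1 + n + 1 = (m + n + 1) + 1 by ring, fpV_succ, ← ih]
    simp only [mul_assoc]

lemma fpV_succ' (n : ℕ) : fpV q v α (n + 1) = fpV q v α n * (q - α • (1 : M)) * v := by
  have := fpV_add (q := q) (v := v) (α := α) n 0
  rw [fpV_zero] at this
  exact this.symm


namespace FpSetup

lemma bs (h : FpSetup T q v α) : star (q - α • (1 : M)) = q - α • (1 : M) := by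
  simp [h.qs]

lemma qb (h : FpSetup T q v α) : q * (q - α • (1 : M)) = (1 - α) • q := by
  rw [mul_sub, h.qq, mul_smul_comm, mul_one, sub_smul, one_smul]

lemma bb (h : FpSetup T q v α) : (q - α • (1 : M)) * (q - α • (1 : M)) =
    (1 - 2 * α) • (q - α • (1 : M)) + (α * (1 - α)) • (1 : M) := by
  rw [sub_mul, h.qb, smul_mul_assoc, one_mul]
  module

lemma vqv (h : FpSetup T q v α) : v * q * v = v * (q - α • (1 : M)) * v + α • (1 : M) := by
  rw [mul_sub, sub_mul, mul_smul_comm, mul_one, smul_mul_assoc, h.vv, sub_add_cancel]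

lemma qqz (h : FpSetup T q v α) (z : M) : q * (q * z) = q * z := by
  rw [← mul_assoc, h.qq]

lemma vvz (h : FpSetup T q v α) (z : M) : v * (v * z) = z := by
  rw [← mul_assoc, h.vv, one_mul]

lemma starV (h : FpSetup T q v α) (n : ℕ) : star (fpV q v α n) = fpV q v α n := by
  induction n with
  | zero => rw [fpV_zero, h.vs]
  | succ n ih =>
    rw [fpV_succ, star_mul, star_mul, ih, h.bs, h.vs, ← mul_assoc, ← fpV_succ', fpV_succ]

lemma starY (h : FpSetup T q v α) (n : ℕ) : star (fpY q v α n) = fpY q v α n := by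
  cases n with
  | zero => exact h.qs
  | succ n => simp only [fpY, star_mul, h.qs, h.starV, mul_assoc]

lemma xY0 (h : FpSetup T q v α) : fpY q v α 1 * fpY q v α 0 = fpY q v α 1 := by
  simp only [fpY, mul_assoc, h.qq]

lemma xY1 (h : FpSetup T q v α) : fpY q v α 1 * fpY q v α 1
    = fpY q v α 2 + α • fpY q v α 0 := by
  have e : fpY q v α 1 * fpY q v α 1 = q * (v * q * v) * q := by
    simp only [fpY, fpV_zero, mul_assoc, h.qqz]
  rw [e, h.vqv]
  simp only [fpY, fpV_succ, fpV_zero, mul_add, add_mul, mul_smul_comm, smul_mul_assoc, mul_one,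
    h.qq]

lemma xY (h : FpSetup T q v α) (n : ℕ) : fpY q v α 1 * fpY q v α (n + 2)
    = fpY q v α (n + 3) + (α * (1 - α)) • fpY q v α (n + 1) := by
  have e : fpY q v α 1 * fpY q v α (n + 2)
      = q * (v * q * v) * ((q - α • (1 : M)) * fpV q v α n) * q := by
    simp only [fpY, fpV_succ n, fpV_zero, mul_assoc, h.qqz]
  have e2 : q * ((q - α • (1 : M)) * fpV q v α n) = (1 - α) • (q * fpV q v α n) := by
    rw [← mul_assoc, h.qb, smul_mul_assoc]
  rw [e, h.vqv, mul_add, add_mul, add_mul, mul_smul_comm, mul_one, smul_mul_assoc, e2]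
  simp only [fpY, fpV_succ, smul_mul_assoc, smul_smul, mul_assoc]

lemma TY (h : FpSetup T q v α) (n : ℕ) : T (fpY q v α (n + 1)) = 0 := by
  have e : q * fpV q v α n = (q - α • (1 : M)) * fpV q v α n + α • fpV q v α n := by
    rw [sub_mul, smul_mul_assoc, one_mul, sub_add_cancel]
  simp only [fpY]
  rw [h.tr, h.qqz, e, map_add, h.TbV, map_smul, h.TV]
  simp

lemma TVV (h : FpSetup T q v α) (n : ℕ) :
    T (fpV q v α n * fpV q v α n) = (α * (1 - α)) ^ n := by
  induction n with
  | zero => rw [fpV_zero, h.vv, h.T1, pow_zero]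
  | succ n ih =>
    have e : fpV q v α (n + 1) * fpV q v α (n + 1) =
        fpV q v α n * ((q - α • (1 : M)) * (q - α • (1 : M))) * fpV q v α n := by
      nth_rewrite 1 [fpV_succ']
      rw [fpV_succ]
      simp only [mul_assoc, h.vvz]
    rw [e, h.bb, mul_add, add_mul, mul_smul_comm, smul_mul_assoc, fpV_add, map_add, map_smul,
      h.TV, mul_smul_comm, smul_mul_assoc, mul_one, map_smul, ih, pow_succ]
    simp [mul_comm]

lemma TqZ (h : FpSetup T q v α) (z : M) : T (star z * q * z) ≤ T (star z * z) := by
  have := h.pos ((1 - q) * z)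
  have e : star ((1 - q) * z) * ((1 - q) * z) = star z * z - star z * q * z := by
    have : (1 - q) * (1 - q) = 1 - q := by
      rw [mul_sub, sub_mul, sub_mul, h.qq]; simp
    rw [star_mul, star_sub, star_one, h.qs, mul_assoc, ← mul_assoc (1 - q), this, sub_mul, one_mul,
      mul_sub, mul_assoc]
  rw [e, map_sub] at this
  linarith

lemma TYY (h : FpSetup T q v α) (n : ℕ) :
    T (fpY q v α (n + 1) * fpY q v α (n + 1)) ≤ (α * (1 - α)) ^ n := by
  rw [← h.TVV n]
  set V := fpV q v α n with hV
  have hs : star V = V := h.starV n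
  have e : fpY q v α (n + 1) * fpY q v α (n + 1) = star (V * q) * q * (V * q) := by
    simp only [fpY, star_mul, hs, h.qs, mul_assoc, h.qqz, ← hV]
  have e2 : T (star (V * q) * (V * q)) = T (star V * q * V) := by
    rw [h.tr, star_mul, h.qs, hs]
    simp only [mul_assoc, h.qqz]
  rw [e]
  refine (h.TqZ _).trans ?_
  rw [e2]
  refine (h.TqZ _).trans_eq ?_
  rw [hs]

lemma Tpar (h : FpSetup T q v α) (a b : M) (ha : star a = a) (hb : star b = b) :
    T ((a + b) * (a + b)) ≤ 2 * T (a * a) + 2 * T (b * b) := by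
  have := h.pos (a - b)
  rw [star_sub, ha, hb] at this
  simp only [add_mul, mul_add, sub_mul, mul_sub, map_add, map_sub] at this ⊢
  linarith

/-- positivity for the functional calculus -/
lemma Tcfc (h : FpSetup T q v α) (x : M) (f : ℝ → ℝ) (hf : Continuous f)
    (h0 : ∀ t ∈ spectrum ℝ x, 0 ≤ f t) : 0 ≤ T (cfc f x) := by
  have e : cfc f x = star (cfc (fun t => Real.sqrt (f t)) x) * cfc (fun t => Real.sqrt (f t)) x := by
    have hs : IsSelfAdjoint (cfc (fun t => Real.sqrt (f t)) x) := cfc_predicate _ _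
    rw [hs.star_eq, ← cfc_mul _ _ x]
    exact cfc_congr fun t ht => (Real.mul_self_sqrt (h0 t ht)).symm
  rw [e]
  exact h.pos _

lemma Tle (h : FpSetup T q v α) (x : M) (hx : star x = x) : T x ≤ ‖x‖ := by
  have hx' : IsSelfAdjoint x := hx
  have : 0 ≤ T (cfc (fun t : ℝ => ‖x‖ - t) x) := by
    refine h.Tcfc x _ (by fun_prop) fun t ht => ?_
    have h1 := norm_apply_le_norm_cfc (fun t : ℝ => t) x ht
    rw [cfc_id' ℝ x] at h1
    have := le_abs_self t
    rw [Real.norm_eq_abs] at h1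
    linarith
  rw [cfc_sub (fun _ => ‖x‖) (fun t => t) x, cfc_id' ℝ x, cfc_const _ x, map_sub,
    Algebra.algebraMap_eq_smul_one, map_smul, h.T1] at this
  simp at this
  linarith

end FpSetup

/-- scalar recursion -/
def fpG (α : ℝ) : ℕ → ℝ → ℝ
  | 0 => fun t => t * t
  | 1 => fun t => t * (t * t) - α * t
  | (n + 2) => fun t => t * fpG α (n + 1) t - (α * (1 - α)) * fpG α n t

lemma fpG_cont (α : ℝ) (n : ℕ) : Continuous (fpG α n) ∧ Continuous (fpG α (n + 1)) := by
  induction n with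
  | zero => constructor <;> (unfold fpG; fun_prop)
  | succ n ih =>
    refine ⟨ih.2, ?_⟩
    obtain ⟨h1, h2⟩ := ih
    simp only [fpG]
    fun_prop

lemma FpSetup.cfcG (h : FpSetup T q v α) (n : ℕ) :
    cfc (fpG α n) (fpY q v α 1) = fpY q v α 1 * fpY q v α (n + 1) ∧
    cfc (fpG α (n + 1)) (fpY q v α 1) = fpY q v α 1 * fpY q v α (n + 2) := by
  have hx : IsSelfAdjoint (fpY q v α 1) := h.starY 1
  have hid := cfc_id' ℝ (fpY q v α 1)
  induction n with
  | zero =>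
    have e0 : cfc (fpG α 0) (fpY q v α 1) = fpY q v α 1 * fpY q v α 1 := by
      simp only [fpG]
      rw [cfc_mul (fun t => t) (fun t => t) _, hid]
    refine ⟨e0, ?_⟩
    simp only [fpG]
    rw [cfc_sub (fun t => t * (t * t)) (fun t => α * t) _,
      cfc_mul (fun t => t) (fun t => t * t) _, cfc_mul (fun t => t) (fun t => t) _,
      cfc_const_mul α (fun t => t) _, hid]
    rw [h.xY1, mul_add, mul_smul_comm, h.xY0]
    simp
  | succ n ih =>
    refine ⟨ih.2, ?_⟩
    have c1 := (fpG_cont α n).1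
    have c2 := (fpG_cont α n).2
    simp only [fpG]
    rw [cfc_sub (fun t => t * fpG α (n + 1) t) (fun t => (α * (1 - α)) * fpG α n t) _
        (by fun_prop) (by fun_prop),
      cfc_mul (fun t => t) (fpG α (n + 1)) _ (by fun_prop) (by fun_prop),
      cfc_const_mul (α * (1 - α)) (fpG α n) _ (by fun_prop), hid, ih.1, ih.2]
    rw [show fpY q v α (n + 1 + 2) = fpY q v α 1 * fpY q v α (n + 2) -
      (α * (1 - α)) • fpY q v α (n + 1) by rw [h.xY]; simp]
    rw [mul_sub (fpY q v α 1), mul_smul_comm]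

lemma fpG_growth {α s lam t : ℝ} (hs : 0 < s) (hs2 : s ^ 2 = α * (1 - α)) (hl : s < lam)
    (hl1 : lam ≤ 1 - α) (ht : lam + s ≤ |t|) (hα : 0 < α) (n : ℕ) :
    lam * |fpG α n t| ≤ |fpG α (n + 1) t| := by
  have hl0 : 0 < lam := hs.trans hl
  have ht2 : lam + s ^ 2 / lam ≤ |t| := by
    refine le_trans ?_ ht
    have : s ^ 2 / lam ≤ s := by rw [div_le_iff₀ hl0]; nlinarith
    linarith
  have hd : 0 < s ^ 2 / lam := by positivity
  induction n with
  | zero =>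
    simp only [fpG]
    have e : t * (t * t) - α * t = t * (|t| * |t| - α) := by rw [abs_mul_abs_self]; ring
    have hk : α ≤ |t| * (|t| - lam) := by
      have h1 : α ≤ (lam + s ^ 2 / lam) * (s ^ 2 / lam) := by
        have e1 : (lam + s ^ 2 / lam) * (s ^ 2 / lam) = s ^ 2 + (s ^ 2 / lam) ^ 2 := by
          field_simp
        have h2 : α ≤ s ^ 2 / lam := by
          rw [le_div_iff₀ hl0, hs2]
          exact mul_le_mul_of_nonneg_left hl1 hα.le
        rw [e1, hs2]
        rw [hs2] at h2
        nlinarith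
      refine h1.trans ?_
      apply mul_le_mul ht2 (by linarith) hd.le (abs_nonneg t)
    rw [e, abs_mul, abs_mul]
    have : lam * |t| ≤ |(|t| * |t| - α)| := le_trans (by linarith) (le_abs_self _)
    nlinarith [abs_nonneg t]
  | succ n ih =>
    simp only [fpG]
    have h1 : |t| * |fpG α (n + 1) t| - s ^ 2 * |fpG α n t| ≤
        |t * fpG α (n + 1) t - α * (1 - α) * fpG α n t| := by
      have := abs_sub_abs_le_abs_sub (t * fpG α (n + 1) t) (α * (1 - α) * fpG α n t)
      rw [abs_mul, abs_mul, ← hs2, abs_of_nonneg (sq_nonneg s)] at this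
      rw [← hs2]; exact this
    have h2 : s ^ 2 * |fpG α n t| ≤ s ^ 2 / lam * |fpG α (n + 1) t| := by
      rw [div_mul_eq_mul_div, le_div_iff₀ hl0, mul_assoc]
      apply mul_le_mul_of_nonneg_left _ (sq_nonneg s)
      linarith
    nlinarith [abs_nonneg (fpG α (n + 1) t)]

lemma FpSetup.TGG (h : FpSetup T q v α) {s : ℝ} (hs2 : s ^ 2 = α * (1 - α)) (n : ℕ) :
    T (cfc (fun t => fpG α (n + 1) t * fpG α (n + 1) t) (fpY q v α 1)) ≤
      4 * s ^ 4 * (s ^ 2) ^ n := by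
  have c2 := (fpG_cont α n).2
  rw [cfc_mul _ _ _ (by fun_prop) (by fun_prop), (h.cfcG n).2, h.xY]
  refine (h.Tpar _ _ (h.starY _) ?_).trans ?_
  · rw [star_smul, h.starY]; simp
  · have h1 := h.TYY (n + 2)
    have h2 := h.TYY n
    rw [smul_mul_smul_comm, map_smul, smul_eq_mul]
    rw [← hs2] at *
    have h3 := mul_le_mul_of_nonneg_left h2 (by positivity : 0 ≤ s ^ 2 * s ^ 2)
    rw [pow_add] at h1
    nlinarith

lemma FpSetup.upper (h : FpSetup T q v α) {s : ℝ} (hs : 0 < s) (hs2 : s ^ 2 = α * (1 - α))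
    (hα : 0 < α) (hα2 : α < 1 / 2) : ‖fpY q v α 1‖ ≤ 2 * s := by
  have hx : IsSelfAdjoint (fpY q v α 1) := h.starY 1
  apply le_of_forall_gt_imp_ge_of_dense
  intro R hR
  obtain ⟨lam, hl, hl1, hlR⟩ : ∃ lam, s < lam ∧ lam ≤ 1 - α ∧ lam + s ≤ R := by
    refine ⟨min (1 - α) (R - s), lt_min ?_ (by linarith), min_le_left _ _, ?_⟩
    · apply lt_of_pow_lt_pow_left₀ 2 (by linarith)
      rw [hs2]; nlinarith
    · have := min_le_right (1 - α) (R - s); linarith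
  have hl0 : 0 < lam := hs.trans hl
  have hR0 : 0 < R := by linarith
  set f : ℝ → ℝ := fun t => max (|t| - R) 0 with hf
  have fc : Continuous f := by fun_prop
  have key : ∀ n t, (R * lam ^ n) ^ 2 * (f t * f t) ≤ fpG α n t * fpG α n t := by
    intro n t
    rcases le_total |t| R with htR | htR
    · have : f t = 0 := by simp [hf, htR]
      rw [this]; simp; exact mul_self_nonneg _
    · have hg : ∀ n, lam ^ n * (|t| * |t|) ≤ |fpG α n t| := by
        intro n
        induction n with
        | zero => simp [fpG]
        | succ n ih =>
          refine le_trans ?_ (fpG_growth hs hs2 hl hl1 (hlR.trans htR) hα n)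
          rw [pow_succ', mul_assoc]
          exact mul_le_mul_of_nonneg_left ih hl0.le
      have hft : f t = |t| - R := by simp [hf, htR]
      have hle : R * lam ^ n * f t ≤ |fpG α n t| := by
        refine le_trans ?_ (hg n)
        rw [hft, mul_comm R, mul_assoc]
        apply mul_le_mul_of_nonneg_left _ (by positivity)
        nlinarith
      rw [← abs_mul_abs_self (fpG α n t)]
      have h0 : 0 ≤ R * lam ^ n * f t := by
        rw [hft]; have : 0 ≤ |t| - R := by linarith
        positivity
      nlinarith [mul_self_le_mul_self h0 hle]
  have hbound : ∀ n : ℕ, T (cfc (fun t => f t * f t) (fpY q v α 1)) ≤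
      (4 * s ^ 4 / (R * lam) ^ 2) * ((s / lam) ^ 2) ^ n := by
    intro n
    have c2 := (fpG_cont α n).2
    have h1 : 0 ≤ T (cfc (fun t => fpG α (n + 1) t * fpG α (n + 1) t -
        (R * lam ^ (n + 1)) ^ 2 * (f t * f t)) (fpY q v α 1)) :=
      h.Tcfc _ _ (by fun_prop) fun t _ => sub_nonneg.2 (key (n + 1) t)
    rw [cfc_sub (fun t => fpG α (n + 1) t * fpG α (n + 1) t)
      (fun t => (R * lam ^ (n + 1)) ^ 2 * (f t * f t)) _ (by fun_prop) (by fun_prop),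
      cfc_const_mul _ (fun t => f t * f t) _ (by fun_prop), map_sub, map_smul, smul_eq_mul] at h1
    have h2 := h.TGG hs2 n
    have h3 : T (cfc (fun t => f t * f t) (fpY q v α 1)) ≤
        4 * s ^ 4 * (s ^ 2) ^ n / (R * lam ^ (n + 1)) ^ 2 := by
      rw [le_div_iff₀ (by positivity)]
      linarith
    refine h3.trans_eq ?_
    rw [div_pow, div_pow]
    field_simp
    ring
  have hlim : Filter.Tendsto (fun n : ℕ => (4 * s ^ 4 / (R * lam) ^ 2) * ((s / lam) ^ 2) ^ n)
      Filter.atTop (nhds ((4 * s ^ 4 / (R * lam) ^ 2) * 0)) := by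
    apply Filter.Tendsto.const_mul
    apply tendsto_pow_atTop_nhds_zero_of_lt_one (by positivity)
    have : s / lam < 1 := by rw [div_lt_one hl0]; exact hl
    have h0 : 0 < s / lam := by positivity
    nlinarith
  rw [mul_zero] at hlim
  have hle := ge_of_tendsto' hlim hbound
  have hfs : IsSelfAdjoint (cfc f (fpY q v α 1)) := cfc_predicate _ _
  have hf0 : cfc f (fpY q v α 1) = 0 := by
    apply h.faithful
    apply le_antisymm _ (h.pos _)
    rw [hfs.star_eq, ← cfc_mul _ _ _ (by fun_prop) (by fun_prop)]
    exact hle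
  rw [← cfc_id' ℝ (fpY q v α 1)]
  refine norm_cfc_le hR0.le fun t ht => ?_
  have h4 := norm_apply_le_norm_cfc f (fpY q v α 1) ht
  rw [hf0, norm_zero, Real.norm_eq_abs] at h4
  have h5 := le_abs_self (f t)
  have h6 : |t| - R ≤ f t := le_max_left _ _
  rw [Real.norm_eq_abs]
  linarith

lemma fp_sum (b : ℕ → ℝ) (c : ℝ) (hb0 : b 0 = 0) (hb : ∀ m, b (m + 2) = c * b (m + 1) - b m)
    (a a' : ℕ → ℝ) (h0 : a' 0 = a 1) (h : ∀ m, a' (m + 1) = a (m + 2) + a m) (N : ℕ) :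
    ∑ m ∈ Finset.range (N + 1), b (m + 1) * a' m =
      c * ∑ m ∈ Finset.range (N + 1), b (m + 1) * a m + b (N + 1) * a (N + 1) - b (N + 2) * a N := by
  induction N with
  | zero => simp [h0, hb 0, hb0]; ring
  | succ N ih =>
    rw [Finset.sum_range_succ, ih, Finset.sum_range_succ _ (N + 1), h N, hb (N + 1)]
    ring

lemma FpSetup.commY (h : FpSetup T q v α) (n : ℕ) :
    Commute (fpY q v α 1) (fpY q v α n) ∧ Commute (fpY q v α 1) (fpY q v α (n + 1)) := by
  have h0 : Commute (fpY q v α 1) (fpY q v α 0) := by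
    have := congrArg star h.xY0
    rw [star_mul, h.starY, h.starY] at this
    exact h.xY0.trans this.symm
  have h1 : Commute (fpY q v α 1) (fpY q v α 1) := Commute.refl _
  induction n with
  | zero => exact ⟨h0, h1⟩
  | succ n ih =>
    refine ⟨ih.2, ?_⟩
    rcases n with _ | n
    · have e : fpY q v α 2 = fpY q v α 1 * fpY q v α 1 - α • fpY q v α 0 := by
        rw [h.xY1]; simp
      show Commute _ (fpY q v α 2)
      rw [e]
      exact (h1.mul_right h1).sub_right (h0.smul_right α)
    · have e : fpY q v α (n + 3) = fpY q v α 1 * fpY q v α (n + 2) -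
          (α * (1 - α)) • fpY q v α (n + 1) := by
        rw [h.xY]; simp
      show Commute _ (fpY q v α (n + 3))
      rw [e]
      exact (h1.mul_right ih.2).sub_right (ih.1.smul_right _)

/-- the moments `τ(x^n Y_m)/s^(n+m)` -/
def fpA (T : M →ₗ[ℝ] ℝ) (q v : M) (α s : ℝ) (n m : ℕ) : ℝ :=
  T (fpY q v α 1 ^ n * fpY q v α m) / s ^ (n + m)

lemma FpSetup.A0 (h : FpSetup T q v α) (s : ℝ) (n : ℕ) :
    fpA T q v α s (n + 1) 0 = fpA T q v α s n 1 := by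
  unfold fpA
  rw [pow_succ, mul_assoc, h.xY0]

lemma FpSetup.A1 (h : FpSetup T q v α) {s : ℝ} (hs : 0 < s) (n : ℕ) :
    fpA T q v α s (n + 1) 1 = fpA T q v α s n 2 + α / s ^ 2 * fpA T q v α s n 0 := by
  unfold fpA
  rw [pow_succ, mul_assoc, h.xY1, mul_add, mul_smul_comm, map_add, map_smul, smul_eq_mul]
  field_simp
  ring

lemma FpSetup.A2 (h : FpSetup T q v α) {s : ℝ} (hs : 0 < s) (hs2 : s ^ 2 = α * (1 - α))
    (n m : ℕ) :
    fpA T q v α s (n + 1) (m + 2) = fpA T q v α s n (m + 3) + fpA T q v α s n (m + 1) := by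
  unfold fpA
  rw [pow_succ, mul_assoc, h.xY, mul_add, mul_smul_comm, map_add, map_smul, smul_eq_mul, ← hs2]
  field_simp
  ring

lemma FpSetup.A_nonneg (h : FpSetup T q v α) {s : ℝ} (hs : 0 < s) (hs2 : s ^ 2 = α * (1 - α))
    (hα : 0 < α) (n m : ℕ) : 0 ≤ fpA T q v α s n m := by
  induction n generalizing m with
  | zero =>
    rcases m with _ | m
    · simp [fpA, fpY, h.Tq, hα.le]
    · simp [fpA, h.TY]
  | succ n ih =>
    rcases m with _ | _ | m
    · rw [h.A0]; exact ih 1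
    · rw [h.A1 hs]
      have := ih 2
      have := ih 0
      positivity
    · rw [h.A2 hs hs2]
      have := ih (m + 3)
      have := ih (m + 1)
      positivity

lemma FpSetup.A_le (h : FpSetup T q v α) {s : ℝ} (hs : 0 < s) (n m : ℕ) :
    fpA T q v α s n m ≤ (‖fpY q v α m‖ / s ^ m) * (‖fpY q v α 1‖ / s) ^ n := by
  unfold fpA
  rw [div_pow, div_mul_div_comm, ← pow_add, add_comm m n]
  apply div_le_div_of_nonneg_right _ (by positivity)
  refine (h.Tle _ ?_).trans ?_
  · rw [star_mul, star_pow, h.starY, h.starY]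
    exact ((h.commY m).1.pow_left n).eq.symm
  · rw [mul_comm (‖fpY q v α m‖)]
    refine (norm_mul_le _ _).trans (mul_le_mul_of_nonneg_right ?_ (norm_nonneg _))
    have : Nontrivial M := ⟨1, 0, fun e => by
      have := h.T1
      rw [e, map_zero] at this
      norm_num at this⟩
    exact norm_pow_le _ n

lemma FpSetup.lower_N (h : FpSetup T q v α) {s : ℝ} (hs : 0 < s) (hs2 : s ^ 2 = α * (1 - α))
    (hα : 0 < α) (hα1 : α < 1) (N : ℕ) :
    2 * Real.cos (Real.pi / (N + 2)) ≤ ‖fpY q v α 1‖ / s := by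
  set θ := Real.pi / (N + 2) with hθ
  have hθ0 : 0 < θ := by positivity
  have hθ1 : θ ≤ Real.pi / 2 := by
    rw [hθ]
    apply div_le_div_of_nonneg_left Real.pi_pos.le (by norm_num)
    have : (0 : ℝ) ≤ N := Nat.cast_nonneg N
    linarith
  have hθN : θ * (N + 2) = Real.pi := by rw [hθ]; field_simp
  have hcos : 0 ≤ Real.cos θ := Real.cos_nonneg_of_mem_Icc ⟨by linarith, hθ1⟩
  set b : ℕ → ℝ := fun m => Real.sin (θ * m) with hbdef
  have hb0 : b 0 = 0 := by simp [hbdef]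
  have hb : ∀ m, b (m + 2) = (2 * Real.cos θ) * b (m + 1) - b m := by
    intro m
    have e1 : θ * ((m + 2 : ℕ) : ℝ) = θ * ((m + 1 : ℕ) : ℝ) + θ := by push_cast; ring
    have e2 : θ * (m : ℝ) = θ * ((m + 1 : ℕ) : ℝ) - θ := by push_cast; ring
    simp only [hbdef]
    rw [e1, e2, Real.sin_add, Real.sin_sub]; ring
  have hbpos : ∀ m, m ≤ N + 2 → 0 ≤ b m := by
    intro m hm
    apply Real.sin_nonneg_of_nonneg_of_le_pi (by positivity)
    rw [← hθN]
    apply mul_le_mul_of_nonneg_left _ hθ0.le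
    exact_mod_cast hm
  have hbN : b (N + 2) = 0 := by
    simp only [hbdef]; push_cast; rw [hθN, Real.sin_pi]
  have hb1 : 0 < b 1 := by
    simp only [hbdef, Nat.cast_one, mul_one]
    exact Real.sin_pos_of_pos_of_lt_pi hθ0 (by linarith [Real.pi_pos])
  have hk : 1 ≤ α / s ^ 2 := by
    rw [hs2, one_le_div (by nlinarith)]; nlinarith
  set A := fpA T q v α s with hA
  have hA0 : ∀ n m, 0 ≤ A n m := h.A_nonneg hs hs2 hα
  set D : ℕ → ℝ := fun n => ∑ m ∈ Finset.range (N + 1), b (m + 1) * A n m with hD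
  have hDs : ∀ n, (2 * Real.cos θ) * D n ≤ D (n + 1) := by
    intro n
    have hsum := fp_sum b (2 * Real.cos θ) hb0 hb (A n)
      (fun m => Nat.casesOn m (A n 1) (fun m => A n (m + 2) + A n m)) rfl (fun m => rfl) N
    have h1 : (2 * Real.cos θ) * D n ≤ ∑ m ∈ Finset.range (N + 1), b (m + 1) *
        (fun m => Nat.casesOn m (A n 1) (fun m => A n (m + 2) + A n m) : ℕ → ℝ) m := by
      rw [hsum, hbN]
      have := mul_nonneg (hbpos (N + 1) (by omega)) (hA0 n (N + 1))
      linarith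
    refine h1.trans (Finset.sum_le_sum fun m hm => ?_)
    have hm' := Finset.mem_range.1 hm
    apply mul_le_mul_of_nonneg_left _ (hbpos _ (by omega))
    rcases m with _ | _ | m
    · exact (h.A0 s n).ge
    · show A n 2 + A n 0 ≤ A (n + 1) 1
      rw [hA, h.A1 hs]
      have := mul_le_mul_of_nonneg_right hk (hA0 n 0)
      rw [hA] at this
      linarith
    · exact (h.A2 hs hs2 n m).ge
  have hD0 : 0 < D 0 := by
    simp only [hD]
    rw [Finset.sum_range_succ']
    have : A 0 0 = α := by simp [hA, fpA, fpY, h.Tq]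
    rw [this]
    have : 0 ≤ ∑ k ∈ Finset.range N, b (k + 1 + 1) * A 0 (k + 1) :=
      Finset.sum_nonneg fun k hk => mul_nonneg
        (hbpos _ (by have := Finset.mem_range.1 hk; omega)) (hA0 _ _)
    have := mul_pos hb1 hα
    simpa using by linarith
  have hDlow : ∀ n, (2 * Real.cos θ) ^ n * D 0 ≤ D n := by
    intro n
    induction n with
    | zero => simp
    | succ n ih =>
      refine le_trans ?_ (hDs n)
      rw [pow_succ', mul_assoc]
      exact mul_le_mul_of_nonneg_left ih (by positivity)
  set r := ‖fpY q v α 1‖ / s with hr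
  have hr0 : 0 ≤ r := by positivity
  obtain ⟨K, hK⟩ : ∃ K, ∀ n, D n ≤ K * r ^ n := by
    refine ⟨∑ m ∈ Finset.range (N + 1), b (m + 1) * (‖fpY q v α m‖ / s ^ m), fun n => ?_⟩
    rw [Finset.sum_mul]
    refine Finset.sum_le_sum fun m hm => ?_
    have hm' := Finset.mem_range.1 hm
    rw [mul_assoc]
    exact mul_le_mul_of_nonneg_left (h.A_le hs n m) (hbpos _ (by omega))
  by_contra hlt
  push Not at hlt
  have hc : 0 < 2 * Real.cos θ := hr0.trans_lt hlt
  have hb2 : ∀ n : ℕ, D 0 ≤ K * (r / (2 * Real.cos θ)) ^ n := by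
    intro n
    rw [div_pow, ← mul_div_assoc, le_div_iff₀ (by positivity), mul_comm]
    exact (hDlow n).trans (hK n)
  have hlim : Filter.Tendsto (fun n : ℕ => K * (r / (2 * Real.cos θ)) ^ n)
      Filter.atTop (nhds (K * 0)) := by
    apply Filter.Tendsto.const_mul
    apply tendsto_pow_atTop_nhds_zero_of_lt_one (by positivity)
    rw [div_lt_one hc]; exact hlt
  have := ge_of_tendsto' hlim hb2
  linarith

lemma FpSetup.lower (h : FpSetup T q v α) {s : ℝ} (hs : 0 < s) (hs2 : s ^ 2 = α * (1 - α))
    (hα : 0 < α) (hα1 : α < 1) : 2 * s ≤ ‖fpY q v α 1‖ := by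
  have hlim : Filter.Tendsto (fun N : ℕ => 2 * Real.cos (Real.pi / ((N : ℝ) + 2)))
      Filter.atTop (nhds (2 * Real.cos 0)) := by
    apply Filter.Tendsto.const_mul
    apply (Real.continuous_cos.tendsto 0).comp
    apply Filter.Tendsto.div_atTop tendsto_const_nhds
    exact Filter.tendsto_atTop_add_const_right _ _ tendsto_natCast_atTop_atTop
  have := le_of_tendsto' hlim (h.lower_N hs hs2 hα hα1)
  rw [Real.cos_zero, mul_one, le_div_iff₀ hs] at this
  exact this

lemma FpSetup.norm_eq (h : FpSetup T q v α) (hα2 : α ≤ 1 / 2) :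
    ‖q * v * q‖ = 2 * Real.sqrt (α * (1 - α)) := by
  have e : fpY q v α 1 = q * v * q := by simp only [fpY, fpV_zero]
  have hα0 : 0 ≤ α := by
    have := h.pos q
    rwa [h.qs, h.qq, h.Tq] at this
  rcases hα0.eq_or_lt with h0 | hα
  · have : q = 0 := by
      apply h.faithful
      rw [h.qs, h.qq, h.Tq, h0]
    simp [this, ← h0]
  have hp : 0 < α * (1 - α) := by nlinarith
  have hs : 0 < Real.sqrt (α * (1 - α)) := Real.sqrt_pos.2 hp
  have hs2 : Real.sqrt (α * (1 - α)) ^ 2 = α * (1 - α) := Real.sq_sqrt hp.le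
  rw [← e]
  refine le_antisymm ?_ (h.lower hs hs2 hα (by linarith))
  rcases hα2.eq_or_lt with h1 | h1
  · have hsq : Real.sqrt (α * (1 - α)) = 1 / 2 := by
      rw [h1, show (1 / 2 : ℝ) * (1 - 1 / 2) = (1 / 2) ^ 2 by norm_num]
      exact Real.sqrt_sq (by norm_num)
    have : Nontrivial M := ⟨1, 0, fun e => by
      have := h.T1
      rw [e, map_zero] at this
      norm_num at this⟩
    have hqn : ‖q‖ ≤ 1 := by
      have := CStarRing.norm_star_mul_self (x := q)
      rw [h.qs, h.qq] at this
      nlinarith [norm_nonneg q]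
    have hvn : ‖v‖ ≤ 1 := by
      have := CStarRing.norm_star_mul_self (x := v)
      rw [h.vs, h.vv, CStarRing.norm_one] at this
      nlinarith [norm_nonneg v]
    rw [hsq, e]
    have a1 := norm_mul_le (q * v) q
    have a2 := norm_mul_le q v
    have a3 : ‖q‖ * ‖v‖ ≤ 1 := mul_le_one₀ hqn (norm_nonneg _) hvn
    have a4 : ‖q * v‖ * ‖q‖ ≤ 1 := mul_le_one₀ (a2.trans a3) (norm_nonneg _) hqn
    linarith
  · exact h.upper hs hs2 hα h1

/-- alternating product -/
def fpW (X Y : M) (m : ℕ) : M :=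
  (List.ofFn fun s : Fin m => if (s : ℕ) % 2 = 0 then X else Y).prod

lemma fpW_succ (X Y : M) (m : ℕ) : fpW X Y (m + 1) = X * fpW Y X m := by
  unfold fpW
  rw [List.ofFn_succ, List.prod_cons]
  simp only [Fin.val_zero, Nat.zero_mod, if_true, Fin.val_succ]
  congr 3
  funext s
  rcases Nat.mod_two_eq_zero_or_one (s : ℕ) with hs | hs
  · rw [if_neg (by omega), if_pos hs]
  · rw [if_pos (by omega), if_neg (by omega)]

lemma fpV_eq (P q : M) (α : ℝ) (n : ℕ) :
    fpV q ((2 : ℝ) • P) α n = (2 : ℝ) ^ (n + 1) • fpW P (q - α • (1 : M)) (2 * n + 1) := by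
  induction n with
  | zero =>
    rw [fpV_zero, fpW_succ]; simp [fpW]
  | succ n ih =>
    rw [fpV_succ, ih, show 2 * (n + 1) + 1 = (2 * n + 1 + 1) + 1 by ring, fpW_succ, fpW_succ]
    simp only [smul_mul_assoc, mul_smul_comm, smul_smul, mul_assoc]
    rw [← fpW_succ P, ← pow_succ]
    exact congrArg (fun z => (2 : ℝ) ^ (n + 1 + 1) • (P * z)) (fpW_succ _ _ (2 * n + 1)).symm

end Aux

theorem norm_qvq_cstar {M : Type*} [CStarAlgebra M]
    (τ : M → ℂ) (hτ : IsTracialState τ) (hτf : IsFaithful τ)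
    (p q : M) (hp : IsProjection p) (hq : IsProjection q)
    (hfree : FreeSets τ {p - τ p • (1 : M)} {q - τ q • (1 : M)})
    (h1 : (τ q).re ≤ (τ p).re) (h2 : (τ p).re = 1 / 2) :
    ‖q * (2 * p - 1) * q‖ = 2 * Real.sqrt ((τ q).re * (1 - (τ q).re)) := by
  obtain ⟨hlin, hone, hpos, htr⟩ := hτ
  have hreal : ∀ e : M, IsProjection e → τ e = ((τ e).re : ℂ) := by
    intro e he
    have := hpos e
    rw [he.1, he.2] at this
    exact Complex.eq_re_of_ofReal_le (r := 0) (by simpa using this)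
  have hadd : ∀ x y, τ (x + y) = τ x + τ y := fun x y => by simpa using hlin 1 x y
  have hzero : τ 0 = 0 := by
    have := hadd 0 0
    simpa using this
  have hsmul : ∀ (c : ℂ) x, τ (c • x) = c * τ x := fun c x => by simpa [hzero] using hlin c x 0
  let T : M →ₗ[ℝ] ℝ :=
    { toFun := fun x => (τ x).re
      map_add' := fun x y => by rw [hadd]; simp
      map_smul' := fun c x => by
        rw [← Complex.coe_smul, hsmul]; simp }
  have hT : ∀ x, T x = (τ x).re := fun x => rfl
  set α : ℝ := (τ q).re with hα
  have hqα : τ q • (1 : M) = α • (1 : M) := by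
    rw [hreal q hq, Complex.coe_smul]
  have hpα : τ p • (1 : M) = (1 / 2 : ℝ) • (1 : M) := by
    rw [hreal p hp, Complex.coe_smul, h2]
  rw [hqα, hpα] at hfree
  set P := p - (1 / 2 : ℝ) • (1 : M) with hP
  have hv : 2 * p - 1 = (2 : ℝ) • P := by
    rw [hP, smul_sub, smul_smul, two_smul, two_mul]; norm_num
  have hW1 : ∀ m, 1 ≤ m → τ (fpW P (q - α • (1 : M)) m) = 0 := by
    intro m hm
    refine hfree m hm _ (Or.inl fun s => ?_)
    split_ifs <;> simp
  have hW2 : ∀ m, 1 ≤ m → τ (fpW (q - α • (1 : M)) P m) = 0 := by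
    intro m hm
    refine hfree m hm _ (Or.inr fun s => ?_)
    split_ifs <;> simp
  have S : FpSetup T q (2 * p - 1) α :=
    { qs := hq.1
      qq := hq.2
      vs := by
        rw [star_sub, star_mul, hp.1, star_one, star_ofNat]
        congr 1
        rw [two_mul, mul_two]
      vv := by
        have : (2 * p - 1) * (2 * p - 1) = 4 * (p * p) - 4 * p + 1 := by noncomm_ring
        rw [this, hp.2]; simp
      T1 := by rw [hT, hone]; simp
      pos := fun x => (Complex.le_def.1 (hpos x)).1
      tr := fun x y => by rw [hT, hT, htr]
      faithful := fun x hx => by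
        apply hτf
        have := (Complex.le_def.1 (hpos x)).2
        apply Complex.ext
        · exact hx
        · exact this.symm
      Tq := rfl
      TV := fun n => by
        rw [hv, fpV_eq, map_smul, hT, hW1 _ (by omega)]; simp
      TbV := fun n => by
        rw [hv, fpV_eq, mul_smul_comm, ← fpW_succ, map_smul, hT, hW2 _ (by omega)]; simp }
  exact S.norm_eq (by linarith)

/-- (Voiculescu) If `p, q` are freely independent projections
with `τ(q) ≤ τ(p) = 1/2`, and `v = 2p - 1`, then `‖q v q‖ = 2√(τ(q)(1-τ(q)))`. -/
theorem norm_qvq_free_projections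
    {M : Type*} [NormedRing M] [StarRing M] [CStarRing M] [NormedAlgebra ℂ M]
    [StarModule ℂ M] [CompleteSpace M]
    (τ : M → ℂ) (hτ : IsTracialState τ) (hτf : IsFaithful τ)
    (p q : M) (hp : IsProjection p) (hq : IsProjection q)
    (hfree : FreeSets τ {p - τ p • (1 : M)} {q - τ q • (1 : M)})
    (h1 : (τ q).re ≤ (τ p).re) (h2 : (τ p).re = 1 / 2) :
    ‖q * (2 * p - 1) * q‖ = 2 * Real.sqrt ((τ q).re * (1 - (τ q).re)) := by
  let _ : CStarAlgebra M := { }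
  exact norm_qvq_cstar τ hτ hτf p q hp hq hfree h1 h2
end

section
/- Let M be a unital C*-algebra with a faithful tracial state τ, let k ≥ 1, and let u₁, …, u_k ∈ M be freely independent Haar unitaries with respect to τ. Then ‖Σ_{i=1}^k (uᵢ + uᵢ*)‖ = 2√(2k−1). -/
open scoped BigOperators ComplexOrder

set_option linter.unusedSectionVars false

namespace Kesten

section Alg
variable {M : Type*} [Ring M] [StarRing M] [Algebra ℂ M] {k : ℕ}

/-- Letters. -/
def X (u : Fin k → M) (l : Fin k × Bool) : M := if l.2 then u l.1 else star (u l.1)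

/-- Inverse letter. -/
def inv (l : Fin k × Bool) : Fin k × Bool := (l.1, !l.2)

theorem inv_inv (l : Fin k × Bool) : inv (inv l) = l := by simp [inv]

/-- Sum of reduced words of length `m+1` starting with the letter `l`. -/
noncomputable def E (u : Fin k → M) : ℕ → Fin k × Bool → M
  | 0, l => X u l
  | m + 1, l => X u l * ∑ l' ∈ Finset.univ.erase (inv l), E u m l'

/-- Sum of reduced words of length `m`. -/
noncomputable def S (u : Fin k → M) : ℕ → M
  | 0 => 1
  | m + 1 => ∑ l, E u m l

theorem X_inv_mul (u : Fin k → M) (hu : ∀ i, IsUnitary (u i)) (l : Fin k × Bool) :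
    X u (inv l) * X u l = 1 := by
  rcases l with ⟨i, _ | _⟩ <;> simp [X, inv, (hu i).1, (hu i).2]

theorem sum_X (u : Fin k → M) : ∑ l, X u l = ∑ i, (u i + star (u i)) := by
  rw [Fintype.sum_prod_type]
  simp [X]

theorem S_one (u : Fin k → M) : S u 1 = ∑ i, (u i + star (u i)) := by
  rw [← sum_X]; rfl

theorem a_mul (u : Fin k → M) (m : ℕ) :
    (∑ i, (u i + star (u i))) * S u (m + 1) =
      S u (m + 2) + ∑ l, X u (inv l) * E u m l := by
  rw [← sum_X]
  have e : ∑ l, X u (inv l) * E u m l = ∑ l, X u l * E u m (inv l) := by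
    refine Fintype.sum_equiv ⟨inv, inv, inv_inv, inv_inv⟩ _ _ ?_
    intro l
    simp [inv_inv]
  rw [e]
  simp only [S, E, Finset.sum_mul, ← Finset.sum_add_distrib]
  refine Finset.sum_congr rfl fun l _ => ?_
  rw [← mul_add, Finset.sum_erase_add _ _ (Finset.mem_univ _)]

theorem a_mul_one (u : Fin k → M) (hu : ∀ i, IsUnitary (u i)) :
    (∑ i, (u i + star (u i))) * S u 1 = S u 2 + (2 * k : ℕ) • S u 0 := by
  rw [a_mul]
  congr 1
  simp [E, X_inv_mul u hu, S, mul_comm]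

theorem a_mul_succ (u : Fin k → M) (hu : ∀ i, IsUnitary (u i)) (m : ℕ) :
    (∑ i, (u i + star (u i))) * S u (m + 2) = S u (m + 3) + (2 * k - 1 : ℕ) • S u (m + 1) := by
  rw [a_mul]
  congr 1
  simp only [E, ← mul_assoc, X_inv_mul u hu, one_mul, S]
  rw [Finset.sum_comm' (t' := Finset.univ) (s' := fun l => Finset.univ.erase (inv l))]
  · simp [Finset.smul_sum, mul_comm]
  · intro x y
    simp only [Finset.mem_univ, Finset.mem_erase, true_and, and_true]
    constructor <;> rintro h rfl <;> exact h (inv_inv _).symm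

/-- Reduced words in syllable form. -/
def Word (u : Fin k → M) (l : Fin k × Bool) (y : M) : Prop :=
  ∃ (n : ℕ) (L : List ((Fin k × Bool) × ℕ)),
    List.IsChain (fun a b => a.1.1 ≠ b.1.1) ((l, n) :: L) ∧
    y = (((l, n) :: L).map (fun s => X u s.1 ^ (s.2 + 1))).prod

theorem Word.mul {u : Fin k → M} {l l' : Fin k × Bool} {y : M} (h : Word u l' y)
    (hl : l' ≠ inv l) : Word u l (X u l * y) := by
  obtain ⟨n, L, hc, rfl⟩ := h
  by_cases h1 : l.1 = l'.1
  · have : l = l' := by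
      rcases l with ⟨i, b⟩; rcases l' with ⟨j, c⟩
      simp only at h1; subst h1
      cases b <;> cases c <;> simp_all [inv]
    subst this
    refine ⟨n + 1, L, ?_, ?_⟩
    · cases L with
      | nil => simp
      | cons b L => simpa using hc
    · simp [pow_succ', mul_assoc]
  · exact ⟨0, (l', n) :: L, by simpa using ⟨h1, by simpa using hc⟩, by simp⟩

theorem E_mem (u : Fin k → M) (m : ℕ) (l : Fin k × Bool) :
    E u m l ∈ AddSubmonoid.closure {y | Word u l y} := by
  induction m generalizing l with
  | zero => exact AddSubmonoid.subset_closure ⟨0, [], by simp, by simp [E]⟩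
  | succ m ih =>
    rw [E, Finset.mul_sum]
    refine AddSubmonoid.sum_mem _ fun l' hl' => ?_
    have hl : l' ≠ inv l := Finset.ne_of_mem_erase hl'
    have h := ih l'
    generalize E u m l' = z at h ⊢
    induction h using AddSubmonoid.closure_induction with
    | mem y hy => exact AddSubmonoid.subset_closure (Word.mul hy hl)
    | zero => simp
    | add a b _ _ ha hb => rw [mul_add]; exact add_mem ha hb

theorem Word.trace {u : Fin k → M} {τ : M → ℂ} (hfree : AreHaarFree τ u)
    {l : Fin k × Bool} {y : M} (h : Word u l y) : τ y = 0 := by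
  obtain ⟨n, L, hc, rfl⟩ := h
  set K := (l, n) :: L with hK
  have key := hfree K.length (by simp [hK]) (fun s => (K.get s).1.1)
    (fun s => if (K.get s).1.2 then ((K.get s).2 + 1 : ℤ) else -((K.get s).2 + 1 : ℤ))
    (by intro s; split_ifs <;> omega)
    (by
      intro s t hst
      have := List.isChain_iff_getElem.1 hc s (by have := t.2; omega)
      simpa [hst] using this)
  rw [← key]
  congr 2
  conv_lhs => rw [← List.ofFn_get K]
  rw [List.map_ofFn]
  congr 1
  funext s
  simp only [Function.comp, zpowU, X]
  generalize K.get s = z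
  rcases z with ⟨⟨i, _ | _⟩, n⟩
  · have h1 : ¬ (0 : ℤ) ≤ -(n + 1) := by omega
    have h2 : (- -((n : ℤ) + 1)).toNat = n + 1 := by omega
    simp only [Bool.false_eq_true, if_false, if_neg h1, h2]
  · have h1 : (0 : ℤ) ≤ (n + 1) := by omega
    have h2 : ((n : ℤ) + 1).toNat = n + 1 := by omega
    simp only [if_true, if_pos h1, h2]

theorem tau_add {τ : M → ℂ} (hτ : IsTracialState τ) (x y : M) : τ (x + y) = τ x + τ y := by
  simpa using hτ.1 1 x y

theorem tau_zero {τ : M → ℂ} (hτ : IsTracialState τ) : τ 0 = 0 := by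
  simpa using tau_add hτ 0 0

/-- Bundled linear map. -/
noncomputable def tauL {τ : M → ℂ} (hτ : IsTracialState τ) : M →ₗ[ℂ] ℂ where
  toFun := τ
  map_add' := tau_add hτ
  map_smul' c x := by simpa [tau_zero hτ] using hτ.1 c x 0

theorem tau_S {u : Fin k → M} {τ : M → ℂ} (hτ : IsTracialState τ) (hfree : AreHaarFree τ u)
    (m : ℕ) : tauL hτ (S u (m + 1)) = 0 := by
  rw [S, map_sum]
  refine Finset.sum_eq_zero fun l _ => ?_
  have h := E_mem u m l
  generalize E u m l = z at h ⊢
  induction h using AddSubmonoid.closure_induction with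
  | mem y hy => exact Word.trace hfree hy
  | zero => simp
  | add a b _ _ ha hb => rw [map_add, ha, hb, add_zero]

/-- The mixed moments. -/
noncomputable def T (u : Fin k → M) {τ : M → ℂ} (hτ : IsTracialState τ) (n m : ℕ) : ℝ :=
  (tauL hτ ((∑ i, (u i + star (u i))) ^ n * S u m)).re

variable {u : Fin k → M} {τ : M → ℂ} (hτ : IsTracialState τ)

theorem T_zero_zero : T u hτ 0 0 = 1 := by
  have : tauL hτ (1 : M) = 1 := hτ.2.1
  simp [T, S, this]

theorem T_zero_succ (hfree : AreHaarFree τ u) (m : ℕ) : T u hτ 0 (m + 1) = 0 := by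
  simp [T, tau_S hτ hfree]

theorem T_succ_zero (n : ℕ) : T u hτ (n + 1) 0 = T u hτ n 1 := by
  simp only [T, S_one]
  simp [S, pow_succ]

theorem T_succ_one (hu : ∀ i, IsUnitary (u i)) (n : ℕ) :
    T u hτ (n + 1) 1 = T u hτ n 2 + (2 * k) * T u hτ n 0 := by
  simp only [T]
  rw [pow_succ, mul_assoc, a_mul_one u hu, mul_add, mul_smul_comm, map_add, map_nsmul]
  simp

theorem T_succ_succ (hk : 1 ≤ k) (hu : ∀ i, IsUnitary (u i)) (n m : ℕ) :
    T u hτ (n + 1) (m + 2) = T u hτ n (m + 3) + (2 * k - 1) * T u hτ n (m + 1) := by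
  simp only [T]
  rw [pow_succ, mul_assoc, a_mul_succ u hu, mul_add, mul_smul_comm, map_add, map_nsmul]
  have : ((2 * k - 1 : ℕ) : ℝ) = 2 * k - 1 := by
    rw [Nat.cast_sub (by omega)]; push_cast; ring
  rw [nsmul_eq_mul, Complex.add_re, ← this]
  simp

end Alg

/-- Upper bound for sequences satisfying the tree recursion. -/
theorem upper (T : ℕ → ℕ → ℝ) (k : ℝ) (hk : 1 ≤ k) (h00 : T 0 0 = 1)
    (h0 : ∀ m, T 0 (m + 1) = 0) (h1 : ∀ n, T (n + 1) 0 = T n 1)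
    (h2 : ∀ n, T (n + 1) 1 = T n 2 + (2 * k) * T n 0)
    (h3 : ∀ n m, T (n + 1) (m + 2) = T n (m + 3) + (2 * k - 1) * T n (m + 1)) (n : ℕ) :
    T n 0 ≤ (2 * √(2 * k - 1)) ^ n := by
  set s := √(2 * k - 1) with hs
  have hs2 : 2 * k - 1 = s ^ 2 := (Real.sq_sqrt (by linarith)).symm
  have hs0 : 0 ≤ s := Real.sqrt_nonneg _
  have hs1 : 1 ≤ s ^ 2 := by rw [← hs2]; linarith
  have key : ∀ n, T n 0 ≤ (2 * s) ^ n ∧ ∀ m, T n (m + 1) ≤ (2 * s) ^ n * (2 * s ^ (m + 1)) := by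
    intro n
    induction n with
    | zero => exact ⟨by simp [h00], fun m => by rw [h0]; positivity⟩
    | succ n ih =>
      obtain ⟨ih0, ih⟩ := ih
      have hp : 0 ≤ (2 * s) ^ n := by positivity
      refine ⟨?_, ?_⟩
      · rw [h1]; refine (ih 0).trans (le_of_eq ?_); ring
      · intro m
        cases m with
        | zero =>
          rw [h2]
          have e : 2 * k = s ^ 2 + 1 := by linarith
          rw [e]
          have := ih 1
          have h4 : (s ^ 2 + 1) * T n 0 ≤ (s ^ 2 + 1) * (2 * s) ^ n := by gcongr
          have h5 : (2 * s) ^ n * 1 ≤ (2 * s) ^ n * s ^ 2 := by gcongr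
          calc _ ≤ (2 * s) ^ n * (2 * s ^ (1 + 1)) + (s ^ 2 + 1) * (2 * s) ^ n := add_le_add this h4
            _ ≤ (2 * s) ^ n * (4 * s ^ 2) := by
              generalize (2 * s) ^ n = P at *
              have e3 : s ^ (1 + 1) = s ^ 2 := rfl
              rw [e3]
              clear_value s
              linarith
            _ = _ := by ring
        | succ m =>
          rw [h3, hs2]
          have h4 : s ^ 2 * T n (m + 1) ≤ s ^ 2 * ((2 * s) ^ n * (2 * s ^ (m + 1))) := by
            gcongr; exact ih m
          refine (add_le_add (ih (m + 2)) h4).trans (le_of_eq ?_)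
          ring
  exact (key n).1

/-- Lower bound for sequences satisfying the tree recursion. -/
theorem lower (T : ℕ → ℕ → ℝ) (k : ℝ) (hk : 1 ≤ k) (h00 : T 0 0 = 1)
    (h0 : ∀ m, T 0 (m + 1) = 0) (h1 : ∀ n, T (n + 1) 0 = T n 1)
    (h2 : ∀ n, T (n + 1) 1 = T n 2 + (2 * k) * T n 0)
    (h3 : ∀ n m, T (n + 1) (m + 2) = T n (m + 3) + (2 * k - 1) * T n (m + 1)) (L : ℕ)
    (hL : 1 ≤ L) :
    ∃ c > 0, ∀ n, c * (2 * √(2 * k - 1) * Real.cos (Real.pi / (L + 1))) ^ n ≤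
      T (L + n) 0 + T (L + n + 1) 0 := by
  set s := √(2 * k - 1) with hs
  have hs2 : 2 * k - 1 = s ^ 2 := (Real.sq_sqrt (by linarith)).symm
  have hs0 : 0 ≤ s := Real.sqrt_nonneg _
  have hs1 : 1 ≤ s ^ 2 := by rw [← hs2]; linarith
  have hs1' : 1 ≤ s := by nlinarith
  have hpos : ∀ n m, 0 ≤ T n m := by
    intro n
    induction n with
    | zero => intro m; cases m with
      | zero => simp [h00]
      | succ m => simp [h0]
    | succ n ih =>
      intro m
      match m with
      | 0 => rw [h1]; exact ih _
      | 1 => rw [h2]; have := ih 2; have := ih 0; positivity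
      | m + 2 => rw [h3, hs2]; have := ih (m + 3); have := ih (m + 1); positivity
  -- inequality form
  have hrec : ∀ n m, T n (m + 2) + s ^ 2 * T n m ≤ T (n + 1) (m + 1) := by
    intro n m
    cases m with
    | zero => rw [h2]; have := hpos n 0; nlinarith
    | succ m => rw [h3, hs2]
  have hone : ∀ n m, m ≤ n → (n + m) % 2 = 0 → 1 ≤ T n m := by
    intro n
    induction n with
    | zero => intro m hm _; obtain rfl : m = 0 := by omega
              simp [h00]
    | succ n ih =>
      intro m hm hp
      cases m with
      | zero => rw [h1]; exact ih 1 (by omega) (by omega)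
      | succ m =>
        have := ih m (by omega) (by omega)
        have := hrec n m
        have := hpos n (m + 2)
        nlinarith
  set θ := Real.pi / (L + 1) with hθ
  have hL0 : (0 : ℝ) < L + 1 := by positivity
  have hθ0 : 0 < θ := by positivity
  have hθL : (L + 1) * θ = Real.pi := by rw [hθ]; field_simp
  have hθ2 : θ ≤ Real.pi / 2 := by
    have : (1 : ℝ) ≤ L := by exact_mod_cast hL
    rw [hθ]
    gcongr
    linarith
  have hcos : 0 ≤ Real.cos θ := Real.cos_nonneg_of_neg_pi_div_two_le_of_le (by linarith [Real.pi_pos]) hθ2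
  have hsin : 0 < Real.sin θ := Real.sin_pos_of_pos_of_lt_pi hθ0 (by linarith [Real.pi_pos])
  set lam := 2 * s * Real.cos θ with hlam
  have hlam0 : 0 ≤ lam := by positivity
  set c := (s ^ L)⁻¹ with hc
  have hc0 : 0 < c := by positivity
  have hsn : ∀ m : ℕ, m ≤ L → 0 ≤ Real.sin ((m + 1) * θ) := by
    intro m hm
    refine Real.sin_nonneg_of_nonneg_of_le_pi (by positivity) ?_
    rw [← hθL]
    gcongr
  have hv : ∀ m : ℕ, s ^ (m + 1 + 1) * Real.sin ((((m + 2 : ℕ) : ℝ) + 1) * θ)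
      + s ^ 2 * (s ^ m * Real.sin ((m + 1) * θ)) =
      lam * (s ^ (m + 1) * Real.sin (((m + 1 : ℕ) + 1) * θ)) := by
    intro m
    have e1 : (((m + 2 : ℕ) : ℝ) + 1) * θ = (((m + 1 : ℕ) : ℝ) + 1) * θ + θ := by push_cast; ring
    have e2 : ((m : ℝ) + 1) * θ = (((m + 1 : ℕ) : ℝ) + 1) * θ - θ := by push_cast; ring
    rw [e1, e2, Real.sin_add, Real.sin_sub, hlam]
    ring
  have key : ∀ n m, m ≤ L → c * (lam ^ n * (s ^ m * Real.sin ((m + 1) * θ))) ≤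
      T (L + n) m + T (L + n + 1) m := by
    intro n
    induction n with
    | zero =>
      intro m hm
      have hW : 1 ≤ T (L + 0) m + T (L + 0 + 1) m := by
        rcases Nat.mod_two_eq_zero_or_one (L + m) with h | h
        · have := hone (L + 0) m (by omega) (by omega)
          linarith [hpos (L + 0 + 1) m]
        · have := hone (L + 0 + 1) m (by omega) (by omega)
          linarith [hpos (L + 0) m]
      refine le_trans ?_ hW
      rw [pow_zero, one_mul, hc, inv_mul_le_iff₀ (by positivity), mul_one]
      calc s ^ m * Real.sin ((m + 1) * θ) ≤ s ^ L * 1 := by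
            gcongr
            · exact hsn m hm
            · exact Real.sin_le_one _
        _ = _ := mul_one _
    | succ n ih =>
      intro m hm
      rw [pow_succ]
      cases m with
      | zero =>
        have e : L + (n + 1) = L + n + 1 := by ring
        rw [e, h1, h1]
        refine le_trans (le_of_eq ?_) (ih 1 hL)
        have e1 : ((1 : ℕ) + 1 : ℝ) * θ = 2 * θ := by push_cast; ring
        rw [e1, Real.sin_two_mul, hlam]
        push_cast
        ring_nf
      | succ m =>
        have e : L + (n + 1) = L + n + 1 := by ring
        rw [e]
        have r1 := hrec (L + n) m
        have r2 := hrec (L + n + 1) m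
        have i1 := ih m (by omega)
        have i2 : c * (lam ^ n * (s ^ (m + 1 + 1) * Real.sin ((((m + 2 : ℕ) : ℝ) + 1) * θ))) ≤
            T (L + n) (m + 2) + T (L + n + 1) (m + 2) := by
          rcases Nat.lt_or_ge L (m + 2) with h | h
          · obtain rfl : L = m + 1 := by omega
            have : (((m + 2 : ℕ) : ℝ) + 1) * θ = Real.pi + θ := by
              rw [← hθL]; push_cast; ring
            rw [this, add_comm Real.pi θ, Real.sin_add_pi]
            have := hpos (m + 1 + n) (m + 2)
            have := hpos (m + 1 + n + 1) (m + 2)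
            have : 0 ≤ c * (lam ^ n * (s ^ (m + 1 + 1) * Real.sin θ)) := by positivity
            linarith
          · exact ih (m + 2) h
        have i3 := mul_le_mul_of_nonneg_left i1 (sq_nonneg s)
        calc _ = c * lam ^ n * (lam * (s ^ (m + 1) * Real.sin (((m + 1 : ℕ) + 1) * θ))) := by ring
          _ = c * (lam ^ n * (s ^ (m + 1 + 1) * Real.sin ((((m + 2 : ℕ) : ℝ) + 1) * θ)))
              + s ^ 2 * (c * (lam ^ n * (s ^ m * Real.sin ((m + 1) * θ)))) := by
            rw [← hv]; ring
          _ ≤ _ := by linarith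
  refine ⟨c * Real.sin θ, by positivity, fun n => ?_⟩
  have := key n 0 (by omega)
  refine le_trans (le_of_eq ?_) this
  push_cast
  ring_nf

section Ana
variable {M : Type*} [CStarAlgebra M] {τ : M → ℂ} (hτ : IsTracialState τ)

theorem pos (a : M) (f : ℝ → ℝ) (hf : Continuous f)
    (h : ∀ x ∈ spectrum ℝ a, 0 ≤ f x) : 0 ≤ tauL hτ (cfc f a) := by
  have e : cfc f a = star (cfc (fun x => √(f x)) a) * cfc (fun x => √(f x)) a := by
    rw [(cfc_predicate (R := ℝ) (p := IsSelfAdjoint) (fun x => √(f x)) a).star_eq, ← cfc_mul _ _ a]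
    exact cfc_congr fun x hx => (Real.mul_self_sqrt (h x hx)).symm
  rw [e]
  exact hτ.2.2.1 _

theorem mono (a : M) (f g : ℝ → ℝ) (hf : Continuous f) (hg : Continuous g)
    (h : ∀ x ∈ spectrum ℝ a, f x ≤ g x) : (tauL hτ (cfc f a)).re ≤ (tauL hτ (cfc g a)).re := by
  have := pos hτ a (fun x => g x - f x) (hg.sub hf) (fun x hx => sub_nonneg.2 (h x hx))
  rw [cfc_sub g f a, map_sub] at this
  have := (Complex.le_def.1 this).1
  simp at this
  exact this

theorem moment_le (a : M) (ha : IsSelfAdjoint a) (n : ℕ) : (tauL hτ (a ^ n)).re ≤ ‖a‖ ^ n := by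
  have h1 : (1 : M) ≠ 0 := by
    intro h
    have h2 := hτ.2.1
    rw [h, tau_zero hτ] at h2
    exact zero_ne_one h2
  haveI : Nontrivial M := ⟨_, _, h1⟩
  have := mono hτ a (fun x => x ^ n) (fun _ => ‖a‖ ^ n) (by fun_prop) (by fun_prop) (by
    intro x hx
    have hx' : |x| ≤ ‖a‖ := spectrum.norm_le_norm_of_mem hx
    calc x ^ n ≤ |x ^ n| := le_abs_self _
      _ = |x| ^ n := abs_pow _ _
      _ ≤ _ := by gcongr)
  rw [cfc_pow_id a n, cfc_const _ a] at this
  have e : tauL hτ (algebraMap ℝ M (‖a‖ ^ n)) = ((‖a‖ ^ n : ℝ) : ℂ) := by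
    have : algebraMap ℝ M (‖a‖ ^ n) = ((‖a‖ ^ n : ℝ) : ℂ) • (1 : M) := by
      rw [Algebra.algebraMap_eq_smul_one]; exact (Complex.coe_smul _ _).symm
    rw [this, map_smul]
    have : tauL hτ (1 : M) = 1 := hτ.2.1
    simp [this]
  rw [e, Complex.ofReal_re] at this
  exact this

theorem norm_le (hτf : IsFaithful τ) (a : M) (ha : IsSelfAdjoint a) (R : ℝ) (hR : 0 < R)
    (h : ∀ n : ℕ, (tauL hτ (a ^ n)).re ≤ R ^ n) : ‖a‖ ≤ R := by
  set f : ℝ → ℝ := fun x => max (x ^ 2 - R ^ 2) 0 with hf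
  have hfc : Continuous f := by fun_prop
  have hfpos : ∀ x, 0 ≤ f x := fun x => le_max_right _ _
  have hfp := pos hτ a f hfc (fun x _ => hfpos x)
  have hb : ∀ n : ℕ, n * (tauL hτ (cfc f a)).re ≤ R ^ 2 := by
    intro n
    have := mono hτ a (fun x => (n * (R ^ 2) ^ n) • f x) (fun x => (R ^ 2) • x ^ (2 * n))
      (by fun_prop) (by fun_prop) (by
        intro x _
        simp only [smul_eq_mul, hf]
        rcases le_total (x ^ 2 - R ^ 2) 0 with h0 | h0
        · rw [max_eq_right h0, mul_zero, pow_mul]; positivity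
        · rw [max_eq_left h0]
          have hR2 : 0 < R ^ 2 := by positivity
          have ht : 0 ≤ (x ^ 2 - R ^ 2) / R ^ 2 := by positivity
          have hB := one_add_mul_le_pow (a := (x ^ 2 - R ^ 2) / R ^ 2) (by linarith) n
          have e : 1 + (x ^ 2 - R ^ 2) / R ^ 2 = x ^ 2 / R ^ 2 := by field_simp; ring
          rw [e, div_pow, le_div_iff₀ (by positivity)] at hB
          have : n * ((x ^ 2 - R ^ 2) / R ^ 2) * (R ^ 2) ^ n ≤ (x ^ 2) ^ n := by
            have : 0 < (R ^ 2) ^ n := by positivity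
            nlinarith
          rw [pow_mul]
          calc _ = R ^ 2 * (n * ((x ^ 2 - R ^ 2) / R ^ 2) * (R ^ 2) ^ n) := by field_simp
            _ ≤ _ := by gcongr)
    rw [cfc_smul _ f a, cfc_smul _ _ a, cfc_pow_id a, ← Complex.coe_smul, ← Complex.coe_smul,
      map_smul, map_smul, smul_eq_mul, smul_eq_mul, Complex.re_ofReal_mul,
      Complex.re_ofReal_mul] at this
    have h2 := h (2 * n)
    rw [pow_mul R] at h2
    have hRn : 0 < (R ^ 2) ^ n := by positivity
    have h3 : R ^ 2 * (tauL hτ (a ^ (2 * n))).re ≤ R ^ 2 * (R ^ 2) ^ n := by gcongr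
    refine le_of_mul_le_mul_right ?_ hRn
    calc _ = n * (R ^ 2) ^ n * (tauL hτ (cfc f a)).re := by ring
      _ ≤ _ := this.trans h3
  have hre0 : (tauL hτ (cfc f a)).re ≤ 0 := by
    by_contra! hlt
    obtain ⟨n, hn⟩ := exists_nat_gt (R ^ 2 / (tauL hτ (cfc f a)).re)
    rw [div_lt_iff₀ hlt] at hn
    linarith [hb n]
  have hz : tauL hτ (cfc f a) = 0 := by
    obtain ⟨h1, h2⟩ := Complex.le_def.1 hfp
    apply Complex.ext
    · exact le_antisymm hre0 h1
    · exact h2.symm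
  have e : cfc f a = star (cfc (fun x => √(f x)) a) * cfc (fun x => √(f x)) a := by
    rw [(cfc_predicate (R := ℝ) (p := IsSelfAdjoint) (fun x => √(f x)) a).star_eq, ← cfc_mul _ _ a]
    exact cfc_congr fun x hx => (Real.mul_self_sqrt (hfpos x)).symm
  rw [e] at hz
  have hs := hτf _ hz
  rw [hs, mul_zero] at e
  have e2 : cfc f a = cfc (fun _ => (0 : ℝ)) a := by rw [e]; simp
  have heq := (cfc_eq_cfc_iff_eqOn (R := ℝ) ha hfc.continuousOn continuousOn_const).1 e2
  have : ‖cfc (id : ℝ → ℝ) a‖ ≤ R := by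
    refine norm_cfc_le hR.le fun x hx => ?_
    have h1 := heq hx
    have h2 : x ^ 2 - R ^ 2 ≤ f x := le_max_left _ _
    rw [h1] at h2
    have h3 : x ^ 2 - R ^ 2 ≤ 0 := h2
    exact abs_le_of_sq_le_sq (show x ^ 2 ≤ R ^ 2 by linarith) hR.le
  rwa [cfc_id ℝ a] at this

theorem main (hτ : IsTracialState τ) (hτf : IsFaithful τ)
    (k : ℕ) (hk : 1 ≤ k)
    (u : Fin k → M) (hu : ∀ i, IsUnitary (u i)) (hfree : AreHaarFree τ u) :
    ‖∑ i, (u i + star (u i))‖ = 2 * Real.sqrt (2 * (k : ℝ) - 1) := by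
  have hk' : (1 : ℝ) ≤ k := by exact_mod_cast hk
  have hs : 0 < √(2 * (k : ℝ) - 1) := Real.sqrt_pos.2 (by linarith)
  set a := ∑ i, (u i + star (u i)) with ha
  have hsa : IsSelfAdjoint a := by
    simp [IsSelfAdjoint, ha, star_sum, add_comm]
  have hT : ∀ n, (tauL hτ (a ^ n)).re = T u hτ n 0 := by
    intro n; simp [T, S, ha]
  apply le_antisymm
  · refine norm_le hτ hτf a hsa _ (by positivity) fun n => ?_
    rw [hT]
    exact upper (T u hτ) k hk' (T_zero_zero hτ) (T_zero_succ hτ hfree) (T_succ_zero hτ)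
      (T_succ_one hτ hu) (T_succ_succ hτ hk hu) n
  · have hL : ∀ L : ℕ, 1 ≤ L →
        2 * √(2 * (k : ℝ) - 1) * Real.cos (Real.pi / (L + 1)) ≤ ‖a‖ := by
      intro L hL
      obtain ⟨c, hc, h⟩ := lower (T u hτ) k hk' (T_zero_zero hτ) (T_zero_succ hτ hfree)
        (T_succ_zero hτ) (T_succ_one hτ hu) (T_succ_succ hτ hk hu) L hL
      set lam := 2 * √(2 * (k : ℝ) - 1) * Real.cos (Real.pi / (L + 1))
      by_contra! hlt
      have ha0 : 0 ≤ ‖a‖ := norm_nonneg a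
      have hlam : 0 < lam := ha0.trans_lt hlt
      have hB : ∀ n : ℕ, c ≤ (‖a‖ ^ L + ‖a‖ ^ (L + 1)) * (‖a‖ / lam) ^ n := by
        intro n
        have h1 := h n
        rw [← hT, ← hT] at h1
        have h2 := moment_le hτ a hsa (L + n)
        have h3 := moment_le hτ a hsa (L + n + 1)
        rw [div_pow, ← mul_div_assoc, le_div_iff₀ (by positivity)]
        calc _ ≤ _ := h1
          _ ≤ _ := add_le_add h2 h3
          _ = _ := by ring
      have hlim := (tendsto_pow_atTop_nhds_zero_of_lt_one (r := ‖a‖ / lam) (by positivity)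
        ((div_lt_one hlam).2 hlt)).const_mul (‖a‖ ^ L + ‖a‖ ^ (L + 1))
      rw [mul_zero] at hlim
      exact absurd (ge_of_tendsto' hlim hB) (not_le.2 hc)
    have hlim : Filter.Tendsto (fun L : ℕ => 2 * √(2 * (k : ℝ) - 1) *
        Real.cos (Real.pi / ((L : ℝ) + 1))) Filter.atTop
        (nhds (2 * √(2 * (k : ℝ) - 1) * Real.cos 0)) := by
      refine Filter.Tendsto.const_mul _ ((Real.continuous_cos.tendsto 0).comp ?_)
      have := (tendsto_one_div_add_atTop_nhds_zero_nat (𝕜 := ℝ)).const_mul Real.pi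
      simpa [div_eq_mul_inv] using this
    rw [Real.cos_zero, mul_one] at hlim
    refine le_of_tendsto hlim ?_
    filter_upwards [Filter.eventually_ge_atTop 1] with L hL1 using hL L hL1

end Ana

end Kesten

/-- (Kesten) For freely independent Haar unitaries
`u₁, …, u_k` one has `‖Σ (uᵢ + uᵢ*)‖ = 2√(2k-1)`. -/
theorem kesten_norm_laplacian
    {M : Type*} [NormedRing M] [StarRing M] [CStarRing M] [NormedAlgebra ℂ M]
    [StarModule ℂ M] [CompleteSpace M]
    (τ : M → ℂ) (hτ : IsTracialState τ) (hτf : IsFaithful τ)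
    (k : ℕ) (hk : 1 ≤ k)
    (u : Fin k → M) (hu : ∀ i, IsUnitary (u i)) (hfree : AreHaarFree τ u) :
    ‖∑ i, (u i + star (u i))‖ = 2 * Real.sqrt (2 * (k : ℝ) - 1) := by
  letI : CStarAlgebra M := {}
  exact Kesten.main hτ hτf k hk u hu hfree
end

section
/- Let M be a unital C*-algebra with a faithful tracial state τ, let A ⊆ M be a unital abelian C*-subalgebra, and let v ∈ M be a unitary with τ(v) = 0 such that the sets {v, v*} and {a ∈ A : τ(a) = 0} are freely independent sets with respect to τ. Let n ≥ 2 and let p₁, …, pₙ ∈ A be projections with p₁ + ⋯ + pₙ = 1. Then ‖Σ_{i=1}^n pᵢ v pᵢ‖ ≥ 2√(n−1)/n. Moreover, if τ(pᵢ) = 1/n for all i, then ‖Σ_{i=1}^n pᵢ v pᵢ‖ = 2√(n−1)/n; and if n ≥ 3 and ‖Σ_{i=1}^n pᵢ v pᵢ‖ = 2√(n−1)/n, then τ(pᵢ) = 1/n for all i. -/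
open scoped BigOperators ComplexOrder

section Pav
open Polynomial

/-- Orthogonal polynomials of the (rescaled) distribution of `pqp`. -/
noncomputable def pavF (κ β : ℝ) : ℕ → ℝ[X]
  | 0 => 1
  | 1 => X + C κ
  | 2 => X * (X + C κ) - C β
  | (k + 3) => X * pavF κ β (k + 2) - pavF κ β (k + 1)

noncomputable def pavG (κ β : ℝ) : ℕ → ℝ[X]
  | 0 => 0
  | (k + 1) => pavG κ β k + pavF κ β (k + 1)

lemma pavF_rec (κ β : ℝ) (k : ℕ) :
    X * pavF κ β (k + 2) = pavF κ β (k + 3) + pavF κ β (k + 1) := by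
  rw [pavF]; ring

lemma pavF_rec1 (κ β : ℝ) : X * pavF κ β 1 = pavF κ β 2 + C β * pavF κ β 0 := by
  simp [pavF]

lemma pavF_orth (κ β : ℝ) (φ : ℝ[X] →ₗ[ℝ] ℝ) (h0 : ∀ k, φ (pavF κ β (k + 1)) = 0) (j : ℕ) :
    (∀ k, j < k → φ (pavF κ β j * pavF κ β k) = 0) ∧
    (∀ k, j + 1 < k → φ (pavF κ β (j + 1) * pavF κ β k) = 0) := by
  have hC : ∀ (r : ℝ) (P : ℝ[X]), φ (C r * P) = r * φ P := by
    intro r P; rw [← smul_eq_C_mul]; simp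
  induction j with
  | zero =>
    have h1 : ∀ k, 0 < k → φ (pavF κ β 0 * pavF κ β k) = 0 := by
      intro k hk
      obtain ⟨m, rfl⟩ := Nat.exists_eq_succ_of_ne_zero hk.ne'
      simpa [pavF] using h0 m
    refine ⟨h1, ?_⟩
    intro k hk
    obtain ⟨m, rfl⟩ := Nat.exists_eq_add_of_le hk
    have : pavF κ β (0 + 1) * pavF κ β (0 + 1 + 1 + m)
        = pavF κ β (m + 3) + pavF κ β (m + 1) + C κ * pavF κ β (m + 2) := by
      rw [← pavF_rec, show 0 + 1 + 1 + m = m + 2 by ring]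
      simp only [pavF]; ring
    rw [this, map_add, map_add, hC, h0, h0, h0]; simp
  | succ j ih =>
    refine ⟨ih.2, ?_⟩
    intro k hk
    obtain ⟨m, rfl⟩ := Nat.exists_eq_add_of_le hk
    cases j with
    | zero =>
      have e : pavF κ β (0 + 1 + 1) * pavF κ β (0 + 1 + 1 + 1 + m)
        = pavF κ β 1 * pavF κ β (m + 4) + pavF κ β 1 * pavF κ β (m + 2)
          - C β * (pavF κ β 0 * pavF κ β (m + 3)) := by
        have := pavF_rec κ β (m + 1)
        rw [← mul_add, ← this, show 0 + 1 + 1 + 1 + m = m + 3 by ring]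
        have := pavF_rec1 κ β
        simp only [zero_add, Nat.reduceAdd]
        linear_combination (-pavF κ β (m + 3)) * this
      have a1 := ih.2 (m + 4) (by omega)
      have a2 := ih.2 (m + 2) (by omega)
      have a3 := ih.1 (m + 3) (by omega)
      simp only [zero_add] at a1 a2
      rw [e, map_sub, map_add, hC, a1, a2, a3]; simp
    | succ j =>
      have e : pavF κ β (j + 1 + 1 + 1) * pavF κ β (j + 1 + 1 + 1 + 1 + m)
        = pavF κ β (j + 2) * pavF κ β (j + m + 5) + pavF κ β (j + 2) * pavF κ β (j + m + 3)
          - (pavF κ β (j + 1) * pavF κ β (j + m + 4)) := by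
        have := pavF_rec κ β (j + m + 2)
        rw [← mul_add, ← this, show j + 1 + 1 + 1 + 1 + m = j + m + 4 by ring]
        have := pavF_rec κ β j
        linear_combination (-pavF κ β (j + m + 4)) * this
      have a1 := ih.2 (j + m + 5) (by omega)
      have a2 := ih.2 (j + m + 3) (by omega)
      have a3 := ih.1 (j + m + 4) (by omega)
      rw [e, map_sub, map_add, a1, a2, a3]; simp

lemma pavF_norm (κ β : ℝ) (φ : ℝ[X] →ₗ[ℝ] ℝ) (h0 : ∀ k, φ (pavF κ β (k + 1)) = 0) (k : ℕ) :
    φ (pavF κ β (k + 1) * pavF κ β (k + 1)) = β * φ 1 := by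
  have hC : ∀ (r : ℝ) (P : ℝ[X]), φ (C r * P) = r * φ P := by
    intro r P; rw [← smul_eq_C_mul]; simp
  have ho := pavF_orth κ β φ h0
  induction k with
  | zero =>
    have e : pavF κ β (0 + 1) * pavF κ β (0 + 1)
        = pavF κ β 2 + C β * 1 + C κ * pavF κ β 1 := by
      simp only [pavF]; ring
    have a1 := h0 1
    have a2 := h0 0
    simp only [zero_add, Nat.reduceAdd] at a1 a2
    rw [e, map_add, map_add, hC, hC, a1, a2]; simp
  | succ k ih =>
    cases k with
    | zero =>
      have e : pavF κ β (0 + 1 + 1) * pavF κ β (0 + 1 + 1)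
        = pavF κ β 1 * pavF κ β 3 + pavF κ β (0 + 1) * pavF κ β (0 + 1)
          - C β * (pavF κ β 0 * pavF κ β 2) := by
        have h1 := pavF_rec κ β 0
        have h2 := pavF_rec1 κ β
        simp only [zero_add, Nat.reduceAdd] at *
        linear_combination (-pavF κ β 2) * h2 + pavF κ β 1 * h1
      rw [e, map_sub, map_add, hC, ih, (ho 1).1 3 (by omega), (ho 0).1 2 (by omega)]; simp
    | succ j =>
      have e : pavF κ β (j + 1 + 1 + 1) * pavF κ β (j + 1 + 1 + 1)
        = pavF κ β (j + 2) * pavF κ β (j + 4) + pavF κ β (j + 1 + 1) * pavF κ β (j + 1 + 1)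
          - (pavF κ β (j + 1) * pavF κ β (j + 3)) := by
        have h1 := pavF_rec κ β j
        have h2 := pavF_rec κ β (j + 1)
        linear_combination (-pavF κ β (j + 3)) * h1 + pavF κ β (j + 2) * h2
      rw [e, map_sub, map_add, ih, (ho (j + 2)).1 (j + 4) (by omega),
        (ho (j + 1)).1 (j + 3) (by omega)]; simp

lemma pavG_orth (κ β : ℝ) (φ : ℝ[X] →ₗ[ℝ] ℝ) (h0 : ∀ k, φ (pavF κ β (k + 1)) = 0) (N : ℕ) :
    ∀ m, N < m → φ (pavG κ β N * pavF κ β m) = 0 := by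
  induction N with
  | zero => intro m _; simp [pavG]
  | succ N ih =>
    intro m hm
    rw [pavG, add_mul, map_add, ih m (by omega), (pavF_orth κ β φ h0 (N + 1)).1 m hm, add_zero]

lemma pavG_vals (κ β : ℝ) (φ : ℝ[X] →ₗ[ℝ] ℝ) (h0 : ∀ k, φ (pavF κ β (k + 1)) = 0) (N : ℕ) :
    φ (pavG κ β (N + 1) * pavG κ β (N + 1)) = (N + 1) * (β * φ 1) ∧
    ∃ b, b = φ (X * (pavF κ β 1 * pavF κ β 1)) ∧
    φ (X * (pavG κ β (N + 1) * pavG κ β (N + 1))) = 2 * N * (β * φ 1) + b := by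
  have hn := pavF_norm κ β φ h0
  have ho := pavF_orth κ β φ h0
  have hg := pavG_orth κ β φ h0
  induction N with
  | zero =>
    have := hn 0
    simp only [zero_add] at this
    simp [pavG, this]
  | succ N ih =>
    obtain ⟨h1, b, hb, h2⟩ := ih
    refine ⟨?_, b, hb, ?_⟩
    · have e : pavG κ β (N + 1 + 1) * pavG κ β (N + 1 + 1) =
        pavG κ β (N + 1) * pavG κ β (N + 1) + (pavG κ β (N + 1) * pavF κ β (N + 2)
          + pavG κ β (N + 1) * pavF κ β (N + 2))
          + pavF κ β (N + 1 + 1) * pavF κ β (N + 1 + 1) := by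
        rw [pavG]; ring
      rw [e, map_add, map_add, map_add, h1, hg _ _ (by omega), hn]
      push_cast; ring
    · have e : X * (pavG κ β (N + 1 + 1) * pavG κ β (N + 1 + 1)) =
        X * (pavG κ β (N + 1) * pavG κ β (N + 1)) + (pavG κ β (N + 1) * pavF κ β (N + 3)
          + pavG κ β N * pavF κ β (N + 1) + pavF κ β (N + 1) * pavF κ β (N + 1))
          + (pavG κ β (N + 1) * pavF κ β (N + 3)
          + pavG κ β N * pavF κ β (N + 1) + pavF κ β (N + 1) * pavF κ β (N + 1))
          + (pavF κ β (N + 2) * pavF κ β (N + 3) + pavF κ β (N + 1) * pavF κ β (N + 2)) := by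
        have := pavF_rec κ β N
        rw [pavG, pavG]
        linear_combination (2 * pavG κ β N + 2 * pavF κ β (N + 1) + pavF κ β (N + 2)) * this
      rw [e]
      simp only [map_add]
      rw [h2, hg _ _ (by omega), hg _ _ (by omega), hn, (ho _).1 _ (by omega),
        (ho _).1 _ (by omega)]
      push_cast; ring

lemma pav_lower (κ β r : ℝ) (φ : ℝ[X] →ₗ[ℝ] ℝ) (h0 : ∀ k, φ (pavF κ β (k + 1)) = 0)
    (hβ : 0 < β * φ 1) (hpos : ∀ Q : ℝ[X], 0 ≤ φ ((C r - X) * (Q * Q))) : 2 ≤ r := by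
  by_contra hr
  push Not at hr
  set b := φ (X * (pavF κ β 1 * pavF κ β 1)) with hb
  have key : ∀ N : ℕ, (2 * N : ℝ) * (β * φ 1) + b ≤ r * ((N + 1) * (β * φ 1)) := by
    intro N
    obtain ⟨h1, b', hb', h2⟩ := pavG_vals κ β φ h0 N
    have := hpos (pavG κ β (N + 1))
    rw [sub_mul, map_sub, ← smul_eq_C_mul, map_smul, h1, h2, hb', ← hb, smul_eq_mul] at this
    linarith
  obtain ⟨N, hN⟩ := exists_nat_gt ((r * (β * φ 1) - b) / ((2 - r) * (β * φ 1)))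
  rw [div_lt_iff₀ (mul_pos (by linarith) hβ)] at hN
  have := key N
  nlinarith

lemma pavF_growth (κ β x η : ℝ) (hκ : 0 ≤ κ) (hβ : β ≤ 2) (hη : 0 ≤ η) (hx : 2 + η ≤ x) (k : ℕ) :
    2 + 2 * η * k ≤ (pavF κ β (k + 1)).eval x ∧
    2 * η ≤ (pavF κ β (k + 2)).eval x - (pavF κ β (k + 1)).eval x := by
  induction k with
  | zero =>
    simp [pavF]
    constructor
    · linarith
    · nlinarith
  | succ k ih =>
    obtain ⟨h1, h2⟩ := ih
    have h3 : (pavF κ β (k + 3)).eval x = x * (pavF κ β (k + 2)).eval x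
      - (pavF κ β (k + 1)).eval x := by rw [pavF]; simp
    have h4 : 2 + 2 * η * (k + 1 : ℝ) ≤ (pavF κ β (k + 2)).eval x := by linarith
    have h5 : (0:ℝ) ≤ η * k := by positivity
    refine ⟨by push_cast; linarith, ?_⟩
    show 2 * η ≤ (pavF κ β (k + 3)).eval x - (pavF κ β (k + 2)).eval x
    rw [h3]
    nlinarith

section FreeProj

variable {M : Type*} [CStarAlgebra M]

/-- centred element -/
noncomputable def pavCen (t : ℝ) (p : M) : M := p - t • (1 : M)

noncomputable def pavY (t : ℝ) (p q : M) : M :=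
  (t * (1 - t))⁻¹ • (p * q * p - (2 * (t * (1 - t))) • (1 : M))

lemma pav_bpqp (t : ℝ) (p q : M) (hp : p * p = p) (hq : q * q = q) :
    pavCen t q * p * (p * q * p) = pavCen t q * pavCen t p * pavCen t q * p
      + (2 * (t * (1 - t))) • (pavCen t q * p) + (t * (t * (1 - t))) • p := by
  have hp' : ∀ x, p * (p * x) = p * x := fun x => by rw [← mul_assoc, hp]
  simp only [pavCen, sub_mul, mul_sub, smul_mul_assoc, mul_smul_comm, one_mul, mul_one, mul_assoc,
    hp, hq, hp', smul_sub, smul_smul]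
  module

lemma pav_ap (t : ℝ) (p : M) (hp : p * p = p) : pavCen t p * p = (1 - t) • p := by
  simp only [pavCen, sub_mul, hp, smul_mul_assoc, one_mul]
  module

lemma pav_comm (t : ℝ) (p q : M) (hp : p * p = p) : p * pavY t p q = pavY t p q * p := by
  have hp' : ∀ x, p * (p * x) = p * x := fun x => by rw [← mul_assoc, hp]
  simp only [pavY, mul_smul_comm, smul_mul_assoc, mul_sub, sub_mul, mul_assoc, hp, hp', one_mul,
    mul_one]

lemma pav_word (t : ℝ) (p q : M) (hp : p * p = p) (hq : q * q = q)
    (ht0 : 0 < t) (ht1 : t < 1) (k : ℕ) :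
    ((t * (1 - t)) ^ (k + 1)) • (p * aeval (pavY t p q) (pavF ((1 - 2 * t) / (1 - t)) (1 - t)⁻¹ (k + 1)))
      = p * (pavCen t q * pavCen t p) ^ k * pavCen t q * p ∧
    ((t * (1 - t)) ^ (k + 2)) • (p * aeval (pavY t p q) (pavF ((1 - 2 * t) / (1 - t)) (1 - t)⁻¹ (k + 2)))
      = p * (pavCen t q * pavCen t p) ^ (k + 1) * pavCen t q * p := by
  have h1t : (1 - t) ≠ 0 := by linarith
  have ht : t ≠ 0 := ht0.ne'
  set s := t * (1 - t) with hs
  have hs0 : s ≠ 0 := mul_ne_zero ht h1t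
  set a := pavCen t p with ha
  set b := pavCen t q with hb
  set y := pavY t p q with hy
  have hp' : ∀ x, p * (p * x) = p * x := fun x => by rw [← mul_assoc, hp]
  have hcy : p * q * p = s • y + (2 * s) • (1 : M) := by
    rw [hy, pavY, ← hs, smul_smul, mul_inv_cancel₀ hs0]; module
  have hsy : s • y = p * q * p - (2 * s) • (1 : M) := by rw [hcy]; module
  have hbp := pav_bpqp t p q hp hq
  rw [← ha, ← hb, ← hs] at hbp
  have hap := pav_ap t p hp
  rw [← ha] at hap
  have hcom : ∀ P : ℝ[X], aeval y (X * P) = aeval y P * y := by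
    intro P; rw [mul_comm, map_mul, aeval_X]
  induction k with
  | zero =>
    have e1 : (s ^ (0 + 1)) • (p * aeval y (pavF ((1 - 2 * t) / (1 - t)) (1 - t)⁻¹ (0 + 1)))
      = p * (b * a) ^ 0 * b * p := by
      have : aeval y (pavF ((1 - 2 * t) / (1 - t)) (1 - t)⁻¹ (0 + 1))
          = y + ((1 - 2 * t) / (1 - t)) • (1 : M) := by
        simp [pavF, Algebra.algebraMap_eq_smul_one]
      rw [this, zero_add, pow_one, ← mul_smul_comm, smul_add, hsy, smul_smul, pow_zero, mul_one,
        hb, pavCen]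
      simp only [mul_add, mul_sub, mul_smul_comm, sub_mul, smul_mul_assoc, mul_one, mul_assoc, hp,
        hp']
      have : s * ((1 - 2 * t) / (1 - t)) = t * (1 - 2 * t) := by rw [hs]; field_simp
      rw [this, hs]; module
    refine ⟨e1, ?_⟩
    have : aeval y (pavF ((1 - 2 * t) / (1 - t)) (1 - t)⁻¹ (0 + 2))
        = aeval y (pavF ((1 - 2 * t) / (1 - t)) (1 - t)⁻¹ (0 + 1)) * y - (1 - t)⁻¹ • (1 : M) := by
      rw [← hcom]; simp [pavF, Algebra.algebraMap_eq_smul_one]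
    rw [this]
    have : s ^ (0 + 2) • (p * (aeval y (pavF ((1 - 2 * t) / (1 - t)) (1 - t)⁻¹ (0 + 1)) * y
        - (1 - t)⁻¹ • (1 : M))) = (s ^ (0 + 1) •
        (p * (aeval y (pavF ((1 - 2 * t) / (1 - t)) (1 - t)⁻¹ (0 + 1))))) * (s • y)
        - (s ^ 2 * (1 - t)⁻¹) • p := by
      simp only [mul_sub, smul_mul_assoc, mul_smul_comm, mul_one, mul_assoc]
      module
    rw [this, e1, hsy, mul_sub]
    have : p * (b * a) ^ 0 * b * p * (p * q * p) = p * (b * p * (p * q * p)) := by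
      simp only [mul_assoc, pow_zero, one_mul]
    rw [this, hbp]
    have : s ^ 2 * (1 - t)⁻¹ = t * s := by rw [hs]; field_simp
    rw [this]
    simp only [mul_add, mul_smul_comm, hp, pow_zero, zero_add, pow_one, mul_one, mul_assoc]
    module
  | succ k ih =>
    obtain ⟨h1, h2⟩ := ih
    refine ⟨h2, ?_⟩
    show s ^ (k + 3) • (p * aeval y (pavF ((1 - 2 * t) / (1 - t)) (1 - t)⁻¹ (k + 3))) = _
    rw [pavF, map_sub, hcom]
    have : s ^ (k + 3) • (p * (aeval y (pavF ((1 - 2 * t) / (1 - t)) (1 - t)⁻¹ (k + 2)) * y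
        - aeval y (pavF ((1 - 2 * t) / (1 - t)) (1 - t)⁻¹ (k + 1)))) = (s ^ (k + 2) •
        (p * (aeval y (pavF ((1 - 2 * t) / (1 - t)) (1 - t)⁻¹ (k + 2))))) * (s • y)
        - s ^ 2 • (s ^ (k + 1) •
        (p * (aeval y (pavF ((1 - 2 * t) / (1 - t)) (1 - t)⁻¹ (k + 1))))) := by
      simp only [mul_sub, smul_mul_assoc, mul_smul_comm, mul_assoc]
      module
    rw [this, h1, h2, hsy, mul_sub]
    have : p * (b * a) ^ (k + 1) * b * p * (p * q * p)
        = p * (b * a) ^ (k + 1) * (b * p * (p * q * p)) := by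
      simp only [mul_assoc]
    rw [this, hbp]
    have : p * (b * a) ^ (k + 1) * p = (1 - t) • (p * (b * a) ^ k * b * p) := by
      rw [pow_succ, mul_assoc, mul_assoc, mul_assoc, hap]
      simp only [mul_smul_comm, mul_assoc]
    have h5 : p * (b * a) ^ (k + 1) * (b * a * b * p) = p * (b * a) ^ (k + 1 + 1) * b * p := by
      rw [pow_succ _ (k + 1)]; simp only [mul_assoc]
    rw [mul_add, mul_add, mul_smul_comm, mul_smul_comm, this, h5]
    simp only [mul_smul_comm, mul_assoc, mul_one]
    rw [hs]; module

variable (T : M →ₗ[ℂ] ℂ) (p q : M) (t : ℝ)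

noncomputable def pavPhi : ℝ[X] →ₗ[ℝ] ℝ where
  toFun P := (T (p * aeval (pavY t p q) P)).re
  map_add' P Q := by simp [mul_add]
  map_smul' r P := by
    rw [map_smul, mul_smul_comm]
    rw [LinearMap.map_smul_of_tower]; simp

lemma pavPhi_F (htr : ∀ x y, T (x * y) = T (y * x)) (hp : p * p = p) (hq : q * q = q)
    (ht0 : 0 < t) (ht1 : t < 1)
    (hf1 : ∀ k : ℕ, T ((pavCen t q * pavCen t p) ^ (k + 1)) = 0)
    (hf2 : ∀ k : ℕ, T ((pavCen t q * pavCen t p) ^ k * pavCen t q) = 0) (k : ℕ) :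
    pavPhi T p q t (pavF ((1 - 2 * t) / (1 - t)) (1 - t)⁻¹ (k + 1)) = 0 := by
  have h := (pav_word t p q hp hq ht0 ht1 k).1
  have hs : (t * (1 - t)) ^ (k + 1) ≠ 0 :=
    pow_ne_zero _ (mul_ne_zero ht0.ne' (by linarith))
  have h2 : T (p * (pavCen t q * pavCen t p) ^ k * pavCen t q * p) = 0 := by
    rw [htr, ← mul_assoc, ← mul_assoc, hp, mul_assoc, htr]
    have : (pavCen t q * pavCen t p) ^ k * pavCen t q * p
      = (pavCen t q * pavCen t p) ^ (k + 1) + t • ((pavCen t q * pavCen t p) ^ k * pavCen t q) := by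
      have hpp : p = pavCen t p + t • (1 : M) := by rw [pavCen]; module
      conv_lhs => rw [hpp]
      rw [pow_succ, mul_add, mul_smul_comm, mul_one, ← mul_assoc]
      congr 3 <;> simp only [pavCen, sub_add_cancel]
    rw [this, map_add, LinearMap.map_smul_of_tower, hf1, hf2]; simp
  rw [← h, LinearMap.map_smul_of_tower] at h2
  show (T _).re = 0
  rw [(smul_eq_zero.mp h2).resolve_left hs]; simp

variable [PartialOrder M] [StarOrderedRing M]

lemma pav_pos (hpos : ∀ x, 0 ≤ (T (star x * x)).re) (htr : ∀ x y, T (x * y) = T (y * x))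
    (hp : p * p = p) (hps : star p = p) (z : M) (hz : 0 ≤ z) : 0 ≤ (T (p * z)).re := by
  obtain ⟨w, rfl⟩ := CStarAlgebra.nonneg_iff_eq_star_mul_self.mp hz
  have := hpos (w * p)
  rw [star_mul, hps] at this
  rw [← hp, mul_assoc, htr]
  simpa only [mul_assoc] using this

lemma pav_c_nonneg (hps : star p = p) (hq : q * q = q) (hqs : star q = q) : 0 ≤ p * q * p := by
  have : p * q * p = star (q * p) * (q * p) := by
    rw [star_mul, hps, hqs]; simp only [mul_assoc]; rw [← mul_assoc q q, hq]
  rw [this]; exact star_mul_self_nonneg _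

lemma pav_L1 (hpos : ∀ x, 0 ≤ (T (star x * x)).re) (htr : ∀ x y, T (x * y) = T (y * x))
    (hp : p * p = p) (hps : star p = p) (hq : q * q = q) (hqs : star q = q)
    (ht0 : 0 < t) (ht1 : t < 1) (hTp : T p = t)
    (hf1 : ∀ k : ℕ, T ((pavCen t q * pavCen t p) ^ (k + 1)) = 0)
    (hf2 : ∀ k : ℕ, T ((pavCen t q * pavCen t p) ^ k * pavCen t q) = 0) :
    4 * (t * (1 - t)) ≤ ‖p * q * p‖ := by
  have hF := pavPhi_F T p q t htr hp hq ht0 ht1 hf1 hf2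
  have hs : 0 < t * (1 - t) := mul_pos ht0 (by linarith)
  have hc := pav_c_nonneg p q hps hq hqs
  have hcs : IsSelfAdjoint (p * q * p) := .of_nonneg hc
  have hys : IsSelfAdjoint (pavY t p q) := by
    unfold pavY
    exact (IsSelfAdjoint.all _).smul (hcs.sub ((IsSelfAdjoint.all _).smul (.one M)))
  have := pav_lower _ _ ((‖p * q * p‖ - 2 * (t * (1 - t))) / (t * (1 - t))) (pavPhi T p q t) hF
    (by
      have : pavPhi T p q t 1 = t := by simp [pavPhi, hTp]
      rw [this]
      exact mul_pos (inv_pos.mpr (by linarith)) ht0)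
    (by
      intro Q
      show 0 ≤ (T _).re
      apply pav_pos T p hpos htr hp hps
      have h1 : 0 ≤ algebraMap ℝ M ‖p * q * p‖ - p * q * p :=
        sub_nonneg.mpr hcs.le_algebraMap_norm_self
      have h2 : aeval (pavY t p q) (C ((‖p * q * p‖ - 2 * (t * (1 - t))) / (t * (1 - t))) - X)
          = (t * (1 - t))⁻¹ • (algebraMap ℝ M ‖p * q * p‖ - p * q * p) := by
        simp only [map_sub, aeval_C, aeval_X, pavY, Algebra.algebraMap_eq_smul_one]
        rw [div_eq_inv_mul]; module
      have h3 : 0 ≤ (t * (1 - t))⁻¹ • (algebraMap ℝ M ‖p * q * p‖ - p * q * p) :=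
        smul_nonneg (inv_pos.mpr hs).le h1
      rw [← h2] at h3
      have h4 : IsSelfAdjoint (aeval (pavY t p q) Q) := by
        rw [← cfc_polynomial Q (pavY t p q)]; exact cfc_predicate _ _
      have h5 := h4.conjugate_nonneg h3
      convert h5 using 1
      rw [← map_mul, ← map_mul]; congr 1; ring)
  rw [le_div_iff₀ hs] at this
  linarith


lemma pav_L2 (hpos : ∀ x, 0 ≤ (T (star x * x)).re) (htr : ∀ x y, T (x * y) = T (y * x))
    (hfa : ∀ x, (T (star x * x)).re = 0 → x = 0)
    (hp : p * p = p) (hps : star p = p) (hq : q * q = q) (hqs : star q = q)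
    (ht0 : 0 < t) (ht1 : t ≤ 1 / 2) (hTp : T p = t)
    (hf1 : ∀ k : ℕ, T ((pavCen t q * pavCen t p) ^ (k + 1)) = 0)
    (hf2 : ∀ k : ℕ, T ((pavCen t q * pavCen t p) ^ k * pavCen t q) = 0) :
    ‖p * q * p‖ ≤ 4 * (t * (1 - t)) := by
  by_contra hR
  push Not at hR
  have ht1' : t < 1 := by linarith
  have hF := pavPhi_F T p q t htr hp hq ht0 ht1' hf1 hf2
  have hs : 0 < t * (1 - t) := mul_pos ht0 (by linarith)
  have hc := pav_c_nonneg p q hps hq hqs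
  have hcs : IsSelfAdjoint (p * q * p) := .of_nonneg hc
  have hys : IsSelfAdjoint (pavY t p q) := by
    unfold pavY
    exact (IsSelfAdjoint.all _).smul (hcs.sub ((IsSelfAdjoint.all _).smul (.one M)))
  have hnorm := pavF_norm _ _ (pavPhi T p q t) hF
  have h1 : pavPhi T p q t 1 = t := by simp [pavPhi, hTp]
  rw [h1] at hnorm
  have : Nontrivial M := by
    by_contra hM
    rw [not_nontrivial_iff_subsingleton] at hM
    have : p = 0 := Subsingleton.elim _ _
    rw [this, map_zero] at hTp
    exact ht0.ne' (by exact_mod_cast hTp.symm)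
  set s := t * (1 - t) with hsdef
  set y := pavY t p q with hy
  set R := ‖p * q * p‖ with hRdef
  have hspec : R ∈ spectrum ℝ (p * q * p) := CStarAlgebra.norm_mem_spectrum_of_nonneg hc
  have hspecy : (R - 2 * s) / s ∈ spectrum ℝ y := by
    have h2 := spectrum.subset_polynomial_aeval (p * q * p) (C s⁻¹ * (X - C (2 * s)) : ℝ[X])
      ⟨R, hspec, rfl⟩
    have h3 : aeval (p * q * p) (C s⁻¹ * (X - C (2 * s)) : ℝ[X]) = y := by
      rw [hy, pavY, ← hsdef, map_mul, map_sub, aeval_C, aeval_C, aeval_X,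
        Algebra.algebraMap_eq_smul_one, Algebra.algebraMap_eq_smul_one, smul_mul_assoc, one_mul]
    rw [h3] at h2
    convert h2 using 1
    simp [div_eq_inv_mul]
  set l := (R - 2 * s) / s with hl
  have hl2 : 2 < l := by rw [hl, lt_div_iff₀ hs]; linarith
  set η := (l - 2) / 2 with hη
  have hη0 : 0 < η := by rw [hη]; linarith
  let h : ℝ → ℝ := fun x => min 1 (max 0 (x - (2 + η)))
  have hh : Continuous h := by fun_prop
  have hh0 : ∀ x, 0 ≤ h x := fun x => le_min zero_le_one (le_max_left _ _)
  have hh1 : ∀ x, h x ≤ 1 := fun x => min_le_left _ _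
  set H := cfc h y with hH
  have hHs : star H = H := cfc_predicate h y
  have hHH : 0 < (T (p * (H * H))).re := by
    have e : T (p * (H * H)) = T (star (H * p) * (H * p)) := by
      rw [star_mul, hps, hHs]
      have : p * H * (H * p) = (p * (H * H)) * p := by simp only [mul_assoc]
      rw [this, htr _ p, ← mul_assoc p p, hp]
    rw [e]
    refine lt_of_le_of_ne (hpos _) (fun h0 => ?_)
    have hHp : H * p = 0 := hfa _ h0.symm
    have hHc : H * (p * q * p) = 0 := by
      rw [← mul_assoc, ← mul_assoc, hHp]; simp
    have hcy : p * q * p = cfc (fun x : ℝ => s * x + 2 * s) y := by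
      rw [cfc_add_const (2 * s) (fun x : ℝ => s * x) y, cfc_const_mul_id s y,
        Algebra.algebraMap_eq_smul_one, hy, pavY, ← hsdef, smul_smul, mul_inv_cancel₀ hs.ne']
      module
    rw [hcy, hH, ← cfc_mul h (fun x : ℝ => s * x + 2 * s) y (hh.continuousOn) (by fun_prop)] at hHc
    have hm := cfc_map_spectrum (fun x => h x * (s * x + 2 * s)) y (by cfc_tac)
      (Continuous.continuousOn (by fun_prop))
    rw [hHc, spectrum.zero_eq] at hm
    have : h l * (s * l + 2 * s) ∈ ({0} : Set ℝ) := by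
      rw [hm]; exact ⟨l, hspecy, rfl⟩
    have h3 : 0 < h l := by
      apply lt_min one_pos
      apply lt_max_of_lt_right
      rw [hη]; linarith
    have h4 : 0 < s * l + 2 * s := by positivity
    exact (mul_pos h3 h4).ne' this
  have key : ∀ k : ℕ, (2 * η * k) ^ 2 * (T (p * (H * H))).re ≤ (1 - t)⁻¹ * t := by
    intro k
    rw [← hnorm k]
    set F := pavF ((1 - 2 * t) / (1 - t)) (1 - t)⁻¹ (k + 1) with hFdef
    have hnn : 0 ≤ cfc (fun x : ℝ => F.eval x * F.eval x - (2 * η * k) ^ 2 * (h x * h x)) y := by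
      apply cfc_nonneg
      intro x _
      by_cases hx : 2 + η ≤ x
      · have hg := (pavF_growth ((1 - 2 * t) / (1 - t)) (1 - t)⁻¹ x η
          (div_nonneg (by linarith) (by linarith))
          (by rw [inv_le_comm₀ (by linarith) (by norm_num)]; linarith) hη0.le hx k).1
        rw [← hFdef] at hg
        have h5 : 0 ≤ 2 * η * k := by positivity
        have h6 : h x * h x ≤ 1 := mul_le_one₀ (hh1 x) (hh0 x) (hh1 x)
        have h7 : (2 * η * k) ^ 2 * (h x * h x) ≤ (2 * η * k) ^ 2 :=
          mul_le_of_le_one_right (by positivity) h6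
        nlinarith
      · have : h x = 0 := by
          simp only [h]
          rw [max_eq_left (by linarith)]; simp
        rw [this]
        nlinarith [mul_self_nonneg (F.eval x)]
    have e : cfc (fun x : ℝ => F.eval x * F.eval x - (2 * η * k) ^ 2 * (h x * h x)) y
        = aeval y (F * F) - ((2 * η * k) ^ 2) • (H * H) := by
      rw [cfc_sub (fun x : ℝ => F.eval x * F.eval x) (fun x : ℝ => (2 * η * k) ^ 2 * (h x * h x)) y
        (Continuous.continuousOn (by fun_prop)) (Continuous.continuousOn (by fun_prop)),
        cfc_const_mul _ (fun x : ℝ => h x * h x) y (Continuous.continuousOn (by fun_prop)),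
        cfc_mul h h y hh.continuousOn hh.continuousOn, ← hH,
        cfc_mul (fun x : ℝ => F.eval x) (fun x : ℝ => F.eval x) y
          (Continuous.continuousOn (by fun_prop)) (Continuous.continuousOn (by fun_prop)),
        cfc_polynomial F y, map_mul]
    have h8 := pav_pos T p hpos htr hp hps _ hnn
    rw [e, mul_sub, mul_smul_comm, map_sub, LinearMap.map_smul_of_tower, Complex.sub_re,
      Complex.smul_re, smul_eq_mul] at h8
    have h9 : pavPhi T p q t (F * F) = (T (p * aeval y (F * F))).re := rfl
    linarith
  set d := (T (p * (H * H))).re with hd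
  obtain ⟨N, hN⟩ := exists_nat_gt (((1 - t)⁻¹ * t) / ((2 * η) ^ 2 * d))
  rw [div_lt_iff₀ (by positivity)] at hN
  have hk := key (N + 1)
  push_cast at hk
  have h10 : (N : ℝ) ≤ (N + 1 : ℝ) ^ 2 := by
    have : (0 : ℝ) ≤ N := Nat.cast_nonneg N
    nlinarith
  have h11 : (N : ℝ) * ((2 * η) ^ 2 * d) ≤ (N + 1 : ℝ) ^ 2 * ((2 * η) ^ 2 * d) :=
    mul_le_mul_of_nonneg_right h10 (by positivity)
  nlinarith

lemma pav_L3 (hpos : ∀ x, 0 ≤ (T (star x * x)).re) (htr : ∀ x y, T (x * y) = T (y * x))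
    (hp : p * p = p) (hps : star p = p) (hq : q * q = q) (hqs : star q = q)
    (hT1 : T 1 = 1) (hTp : T p = t) (hTq : T q = t) (ht : 1 / 2 < t) :
    1 ≤ ‖p * q * p‖ := by
  by_contra hR
  push Not at hR
  have hc := pav_c_nonneg p q hps hq hqs
  have hcs : IsSelfAdjoint (p * q * p) := .of_nonneg hc
  have hlt : ∀ x ∈ spectrum ℝ (p * q * p), 0 < 1 - x := by
    intro x hx
    have h1 := hcs.le_algebraMap_norm_self
    have h2 : x ≤ ‖p * q * p‖ := (le_algebraMap_iff_spectrum_le hcs).mp h1 x hx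
    linarith
  set c := p * q * p with hcdef
  let g : ℝ → ℝ := fun x => (√(1 - x))⁻¹
  have hg : ContinuousOn g (spectrum ℝ c) := by
    apply ContinuousOn.inv₀
    · exact Continuous.continuousOn (by fun_prop)
    · intro x hx; exact (Real.sqrt_pos.mpr (hlt x hx)).ne'
  set G := cfc g c with hG
  have hGs : star G = G := cfc_predicate g c
  have hpc : p * c = c * p := by
    rw [hcdef, mul_assoc (p * q) p p, hp, ← mul_assoc, ← mul_assoc, hp]
  have hpG : p * G = G * p := by
    have : Commute G p := Commute.cfc_real (show Commute c p from hpc.symm) g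
    exact this.symm
  have hpc' : p * c = c := by rw [hcdef, ← mul_assoc, ← mul_assoc, hp]
  have hG1 : G * (1 - c) * G = 1 := by
    have h1 : (1 : M) - c = cfc (fun x : ℝ => 1 - x) c := by
      rw [cfc_sub (fun _ : ℝ => (1 : ℝ)) (fun x : ℝ => x) c, cfc_const_one ℝ c, cfc_id' ℝ c]
    rw [h1, hG, ← cfc_mul g (fun x : ℝ => 1 - x) c hg (by fun_prop),
      ← cfc_mul (fun x : ℝ => g x * (1 - x)) g c (hg.mul (by fun_prop)) hg, ← cfc_one ℝ c]
    apply cfc_congr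
    intro x hx
    have h2 := hlt x hx
    simp only [g, Pi.one_apply]
    have h3 := Real.mul_self_sqrt h2.le
    have h4 := (Real.sqrt_pos.mpr h2).ne'
    field_simp
    nlinarith
  set w := (1 - q) * p * G with hw
  have hws : star w = G * (p * (1 - q)) := by
    rw [hw]; simp only [star_mul, star_sub, star_one, hps, hqs, hGs]
  have hq1 : (1 - q) * (1 - q) = 1 - q := by
    simp only [mul_sub, sub_mul, mul_one, one_mul, hq, sub_self, sub_zero]
  have hww : star w * w = p := by
    have e1 : p * (1 - q) * ((1 - q) * p) = p * (1 - c) := by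
      have : p * (1 - q) * ((1 - q) * p) = p * ((1 - q) * (1 - q)) * p := by
        simp only [mul_assoc]
      rw [this, hq1, mul_sub, sub_mul, mul_one, hp, mul_sub, mul_one, hpc']
    have e2 : star w * w = G * (p * (1 - q) * ((1 - q) * p)) * G := by
      rw [hws, hw]; simp only [mul_assoc]
    rw [e2, e1, ← mul_assoc, ← hpG, mul_assoc, mul_assoc, ← mul_assoc G, hG1, mul_one]
  have hwp : w * p = w := by
    rw [hw, mul_assoc, ← hpG, ← mul_assoc, mul_assoc _ p p, hp]
  have hqw : (1 - q) * w = w := by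
    rw [hw, ← mul_assoc, ← mul_assoc, hq1]
  set f := w * star w with hf
  have hfs : star f = f := by rw [hf]; simp
  have hff : f * f = f := by
    have : f * f = w * (star w * w) * star w := by rw [hf]; simp only [mul_assoc]
    rw [this, hww, hwp]
  have hqf : (1 - q) * f = f := by rw [hf, ← mul_assoc, hqw]
  have hfq : f * (1 - q) = f := by
    have := congrArg star hqf
    simpa only [star_mul, star_sub, star_one, hqs, hfs] using this
  have hpr : star (1 - q - f) * (1 - q - f) = 1 - q - f := by
    simp only [star_sub, star_one, hqs, hfs]
    rw [sub_mul, mul_sub (1 - q), mul_sub f, hq1, hqf, hfq, hff, sub_self, sub_zero]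
  have h1 := hpos (1 - q - f)
  rw [hpr, map_sub, map_sub, hT1, hTq, hf, htr, hww, hTp] at h1
  simp at h1
  linarith

end FreeProj
end Pav

section Main

lemma pav_listprod {R : Type*} [Monoid R] (u a v : R) (Z : ℕ → R)
    (hZ : Z = fun s => if s % 2 = 1 then a else if s % 4 = 0 then u else v) (k : ℕ) :
    (List.ofFn fun s : Fin (4 * k) => Z s).prod = (u * a * v * a) ^ k := by
  induction k with
  | zero => simp
  | succ k ih =>
    show (List.ofFn fun s : Fin (4 * k + 1 + 1 + 1 + 1) => Z s).prod = _
    have z0 : Z (4 * k) = u := by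
      rw [hZ]; dsimp only; rw [if_neg (by omega), if_pos (by omega)]
    have z1 : Z (4 * k + 1) = a := by
      rw [hZ]; dsimp only; rw [if_pos (by omega)]
    have z2 : Z (4 * k + 1 + 1) = v := by
      rw [hZ]; dsimp only; rw [if_neg (by omega), if_neg (by omega)]
    have z3 : Z (4 * k + 1 + 1 + 1) = a := by
      rw [hZ]; dsimp only; rw [if_pos (by omega)]
    simp only [List.ofFn_succ', List.concat_eq_append, List.prod_append, List.prod_singleton,
      Fin.val_castSucc, Fin.val_last, ih, z0, z1, z2, z3]
    rw [pow_succ]; simp only [mul_assoc]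

lemma pav_listprod3 {R : Type*} [Monoid R] (u a v : R) (Z : ℕ → R)
    (hZ : Z = fun s => if s % 2 = 1 then a else if s % 4 = 0 then u else v) (k : ℕ) :
    (List.ofFn fun s : Fin (4 * k + 3) => Z s).prod = (u * a * v * a) ^ k * (u * a * v) := by
  show (List.ofFn fun s : Fin (4 * k + 1 + 1 + 1) => Z s).prod = _
  have z0 : Z (4 * k) = u := by
    rw [hZ]; dsimp only; rw [if_neg (by omega), if_pos (by omega)]
  have z1 : Z (4 * k + 1) = a := by
    rw [hZ]; dsimp only; rw [if_pos (by omega)]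
  have z2 : Z (4 * k + 1 + 1) = v := by
    rw [hZ]; dsimp only; rw [if_neg (by omega), if_neg (by omega)]
  simp only [List.ofFn_succ', List.concat_eq_append, List.prod_append, List.prod_singleton,
    Fin.val_castSucc, Fin.val_last, pav_listprod u a v Z hZ, z0, z1, z2]
  simp only [mul_assoc]

/-- The trace as a linear map. -/
noncomputable def pavLin {M : Type*} [CStarAlgebra M] (τ : M → ℂ) (hτ : IsTracialState τ) :
    M →ₗ[ℂ] ℂ :=
  have h0 : τ 0 = 0 := by
    have := hτ.1 1 0 0
    simpa using this
  { toFun := τ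
    map_add' := fun x y => by simpa using hτ.1 1 x y
    map_smul' := fun c x => by simpa [h0] using hτ.1 c x 0 }

variable {M : Type*} [CStarAlgebra M] [PartialOrder M] [StarOrderedRing M]

lemma pav_orth {n : ℕ} (T : M →ₗ[ℂ] ℂ) (hpos : ∀ x, 0 ≤ (T (star x * x)).re)
    (hfa : ∀ x, (T (star x * x)).re = 0 → x = 0)
    (p : Fin n → M) (hp : ∀ i, p i * p i = p i) (hps : ∀ i, star (p i) = p i)
    (hcomm : ∀ i j, p i * p j = p j * p i) (hsum : ∑ i, p i = 1) (i j : Fin n) (hij : i ≠ j) :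
    p i * p j = 0 := by
  have h1 : ∑ k, p i * p k = p i := by rw [← Finset.mul_sum, hsum, mul_one]
  rw [← Finset.add_sum_erase _ _ (Finset.mem_univ i), hp] at h1
  have h2 : ∑ k ∈ Finset.univ.erase i, p i * p k = 0 := by simpa using h1
  have h3 : ∀ k, star (p i * p k) * (p i * p k) = p i * p k := by
    intro k
    rw [star_mul, hps, hps, ← hcomm i k, mul_assoc, ← mul_assoc (p k), ← hcomm i k,
      mul_assoc (p i), hp, ← mul_assoc, hp]
  have h4 : ∑ k ∈ Finset.univ.erase i, (T (p i * p k)).re = 0 := by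
    rw [← Complex.re_sum, ← map_sum, h2]; simp
  have h5 := (Finset.sum_eq_zero_iff_of_nonneg (fun k _ => by
    have := hpos (p i * p k); rwa [h3] at this)).mp h4 j (by simp [hij.symm])
  rw [← h3] at h5
  exact hfa _ h5

lemma pav_star_mul {n : ℕ} (p : Fin n → M) (hp : ∀ i, p i * p i = p i)
    (hps : ∀ i, star (p i) = p i) (ho : ∀ i j, i ≠ j → p i * p j = 0) (v : M) :
    star (∑ i, p i * v * p i) * (∑ i, p i * v * p i)
      = ∑ i, p i * (star v * p i * v) * p i := by
  rw [star_sum, Finset.sum_mul]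
  refine Finset.sum_congr rfl fun i _ => ?_
  rw [Finset.mul_sum, Finset.sum_eq_single i]
  · simp only [star_mul, hps, mul_assoc]
    rw [← mul_assoc (p i) (p i), hp]
  · intro j _ hj
    simp only [star_mul, hps, mul_assoc]
    rw [← mul_assoc (p i) (p j), ho i j hj.symm]; simp
  · simp

lemma pav_conj {n : ℕ} (p : Fin n → M) (hp : ∀ i, p i * p i = p i)
    (ho : ∀ i j, i ≠ j → p i * p j = 0) (z : Fin n → M) (i : Fin n) :
    p i * (∑ j, p j * z j * p j) * p i = p i * z i * p i := by
  rw [Finset.mul_sum, Finset.sum_mul, Finset.sum_eq_single i]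
  · rw [← mul_assoc, ← mul_assoc, hp, mul_assoc (p i * z i), hp]
  · intro j _ hj
    rw [← mul_assoc, ← mul_assoc, ho i j hj.symm]; simp
  · simp

lemma pav_norm_proj (p : M) (hp : p * p = p) (hps : star p = p) : ‖p‖ ≤ 1 := by
  have h := CStarRing.norm_star_mul_self (x := p)
  rw [hps, hp] at h
  by_contra h1
  push Not at h1
  nlinarith

lemma pav_norm_lower {n : ℕ} (p : Fin n → M) (hp : ∀ i, p i * p i = p i)
    (hps : ∀ i, star (p i) = p i) (ho : ∀ i j, i ≠ j → p i * p j = 0) (v : M) (i : Fin n) :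
    ‖p i * (star v * p i * v) * p i‖ ≤ ‖∑ i, p i * v * p i‖ ^ 2 := by
  have h1 := pav_star_mul p hp hps ho v
  have h2 := pav_conj p hp ho (fun i => star v * p i * v) i
  rw [← h2, ← h1, pow_two, ← CStarRing.norm_star_mul_self]
  have h3 := pav_norm_proj (p i) (hp i) (hps i)
  calc _ ≤ ‖p i‖ * ‖star (∑ i, p i * v * p i) * ∑ i, p i * v * p i‖ * ‖p i‖ :=
        (norm_mul_le _ _).trans (mul_le_mul_of_nonneg_right (norm_mul_le _ _) (norm_nonneg _))
    _ ≤ 1 * ‖star (∑ i, p i * v * p i) * ∑ i, p i * v * p i‖ * 1 := by gcongr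
    _ = _ := by simp

lemma pav_norm_upper {n : ℕ} (p : Fin n → M) (hp : ∀ i, p i * p i = p i)
    (hps : ∀ i, star (p i) = p i) (ho : ∀ i j, i ≠ j → p i * p j = 0) (hsum : ∑ i, p i = 1)
    (v : M) (R : ℝ) (hR : 0 ≤ R)
    (h : ∀ i, ‖p i * (star v * p i * v) * p i‖ ≤ R) :
    ‖∑ i, p i * v * p i‖ ^ 2 ≤ R := by
  rw [pow_two, ← CStarRing.norm_star_mul_self,
    CStarAlgebra.norm_le_iff_le_algebraMap _ hR (star_mul_self_nonneg _),
    pav_star_mul p hp hps ho v]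
  have e : algebraMap ℝ M R = ∑ i, R • p i := by
    rw [← Finset.smul_sum, hsum, Algebra.algebraMap_eq_smul_one]
  rw [e]
  refine Finset.sum_le_sum fun i _ => ?_
  have hn : 0 ≤ p i * (star v * p i * v) * p i := by
    have : p i * (star v * p i * v) * p i = star (p i * v * p i) * (p i * v * p i) := by
      simp only [star_mul, hps, mul_assoc]
      rw [← mul_assoc (p i) (p i), hp]
    rw [this]; exact star_mul_self_nonneg _
  have h1 := (CStarAlgebra.norm_le_iff_le_algebraMap _ hR hn).mp (h i)
  have h2 := star_left_conjugate_le_conjugate h1 (p i)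
  rw [hps] at h2
  convert h2 using 1
  · simp only [mul_assoc, hp]
    rw [← mul_assoc (p i) (p i), hp]
  · rw [Algebra.algebraMap_eq_smul_one]
    simp [hp]

theorem pav_core (τ : M → ℂ) (hτ : IsTracialState τ) (hτf : IsFaithful τ)
    (A : StarSubalgebra ℂ M)
    (habelian : ∀ a ∈ A, ∀ b ∈ A, a * b = b * a)
    (v : M) (hv : IsUnitary v)
    (hfree : FreeSets τ {v, star v} {a : M | a ∈ A ∧ τ a = 0})
    (n : ℕ) (hn : 2 ≤ n)
    (p : Fin n → M) (hpA : ∀ i, p i ∈ A) (hproj : ∀ i, IsProjection (p i))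
    (hsum : ∑ i, p i = 1) :
    2 * Real.sqrt ((n : ℝ) - 1) / n ≤ ‖∑ i, p i * v * p i‖ ∧
    ((∀ i, τ (p i) = 1 / (n : ℂ)) →
      ‖∑ i, p i * v * p i‖ = 2 * Real.sqrt ((n : ℝ) - 1) / n) ∧
    (3 ≤ n → ‖∑ i, p i * v * p i‖ = 2 * Real.sqrt ((n : ℝ) - 1) / n →
      ∀ i, τ (p i) = 1 / (n : ℂ)) := by
  set T := pavLin τ hτ with hT
  have hTτ : ∀ x, T x = τ x := fun _ => rfl
  have htr : ∀ x y, T (x * y) = T (y * x) := hτ.2.2.2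
  have hT1 : T 1 = 1 := hτ.2.1
  have hposC : ∀ x, 0 ≤ T (star x * x) := hτ.2.2.1
  have hpos : ∀ x, 0 ≤ (T (star x * x)).re := fun x => (Complex.nonneg_iff.mp (hposC x)).1
  have hfa : ∀ x, (T (star x * x)).re = 0 → x = 0 := fun x hx =>
    hτf x (Complex.ext hx (Complex.nonneg_iff.mp (hposC x)).2.symm)
  have hp : ∀ i, p i * p i = p i := fun i => (hproj i).2
  have hps : ∀ i, star (p i) = p i := fun i => (hproj i).1
  have ho := pav_orth T hpos hfa p hp hps (fun i j => habelian _ (hpA i) _ (hpA j)) hsum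
  set t : Fin n → ℝ := fun i => (T (p i)).re with ht
  have hTp : ∀ i, T (p i) = (t i : ℂ) := by
    intro i
    have h := hposC (p i)
    rw [hps, hp] at h
    exact Complex.ext (by simp [ht]) (by simpa using (Complex.nonneg_iff.mp h).2.symm)
  have ht0 : ∀ i, 0 ≤ t i := by
    intro i
    have h := hpos (p i)
    rwa [hps, hp] at h
  have htsum : ∑ i, t i = 1 := by
    rw [ht, ← Complex.re_sum, ← map_sum, hsum, hT1]; simp
  have hqq : ∀ i, (star v * p i * v) * (star v * p i * v) = star v * p i * v := by
    intro i
    have : (star v * p i * v) * (star v * p i * v) = star v * (p i * (v * star v) * p i) * v := by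
      simp only [mul_assoc]
    rw [this, hv.2, mul_one, hp]
  have hqs : ∀ i, star (star v * p i * v) = star v * p i * v := by
    intro i; simp only [star_mul, star_star, hps, mul_assoc]
  have hTq : ∀ i, T (star v * p i * v) = (t i : ℂ) := by
    intro i; rw [htr, ← mul_assoc, hv.2, one_mul, hTp]
  have hcenq : ∀ i, pavCen (t i) (star v * p i * v) = star v * pavCen (t i) (p i) * v := by
    intro i
    simp only [pavCen, mul_sub, sub_mul, mul_smul_comm, smul_mul_assoc, mul_one, hv.1]
  have hcenA : ∀ i, pavCen (t i) (p i) ∈ {a : M | a ∈ A ∧ τ a = 0} := by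
    intro i
    refine ⟨?_, ?_⟩
    · have : pavCen (t i) (p i) = p i - ((t i : ℂ)) • (1 : M) := by
        rw [pavCen]; congr 1
      rw [this]
      exact A.sub_mem (hpA i) (A.smul_mem A.one_mem _)
    · rw [← hTτ, pavCen, map_sub, LinearMap.map_smul_of_tower, hT1, hTp]; simp
  have hword : ∀ i m, 1 ≤ m → T ((List.ofFn fun s : Fin m => (fun s : ℕ => if s % 2 = 1
      then pavCen (t i) (p i) else if s % 4 = 0 then star v else v) s).prod) = 0 := by
    intro i m hm
    refine hfree m hm _ (Or.inl fun s => ?_)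
    dsimp only
    by_cases h1 : (s : ℕ) % 2 = 0
    · rw [if_pos h1, if_neg (by omega)]
      by_cases h2 : (s : ℕ) % 4 = 0
      · rw [if_pos h2]; simp
      · rw [if_neg h2]; simp
    · rw [if_neg h1, if_pos (by omega)]
      exact hcenA i
  have hf1 : ∀ i, ∀ k : ℕ,
      T ((pavCen (t i) (star v * p i * v) * pavCen (t i) (p i)) ^ (k + 1)) = 0 := by
    intro i k
    rw [hcenq, ← pav_listprod (star v) (pavCen (t i) (p i)) v _ rfl (k + 1)]
    exact hword i _ (by omega)
  have hf2 : ∀ i, ∀ k : ℕ, T ((pavCen (t i) (star v * p i * v) * pavCen (t i) (p i)) ^ k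
      * pavCen (t i) (star v * p i * v)) = 0 := by
    intro i k
    rw [hcenq, ← pav_listprod3 (star v) (pavCen (t i) (p i)) v _ rfl k]
    exact hword i _ (by omega)
  set x := ∑ i, p i * v * p i with hx
  have hlow := pav_norm_lower p hp hps ho v
  rw [← hx] at hlow
  have L1 : ∀ i, t i ≤ 1 / 2 → 4 * (t i * (1 - t i)) ≤ ‖x‖ ^ 2 := by
    intro i hi
    rcases (ht0 i).eq_or_lt with h0 | h0
    · rw [← h0]; simp
    · exact (pav_L1 T (p i) (star v * p i * v) (t i) hpos htr (hp i) (hps i) (hqq i) (hqs i) h0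
        (by linarith) (hTp i) (hf1 i) (hf2 i)).trans (hlow i)
  have L3 : ∀ i, 1 / 2 < t i → 1 ≤ ‖x‖ ^ 2 := by
    intro i hi
    exact (pav_L3 T (p i) (star v * p i * v) (t i) hpos htr (hp i) (hps i) (hqq i) (hqs i) hT1
      (hTp i) (hTq i) hi).trans (hlow i)
  have hn' : (2 : ℝ) ≤ n := by exact_mod_cast hn
  have hn0 : (0 : ℝ) < n := by linarith
  have hval : (2 * Real.sqrt ((n : ℝ) - 1) / n) ^ 2 = 4 * (1 / n * (1 - 1 / n)) := by
    rw [div_pow, mul_pow, Real.sq_sqrt (by linarith)]; field_simp; ring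
  have hval0 : 0 ≤ 2 * Real.sqrt ((n : ℝ) - 1) / n := by positivity
  have hninv : (1 : ℝ) / n ≤ 1 / 2 := one_div_le_one_div_of_le two_pos hn'
  have hninv0 : (0 : ℝ) < 1 / n := by positivity
  set r : ℝ := 1 / n with hr
  have hlower : 2 * Real.sqrt ((n : ℝ) - 1) / n ≤ ‖x‖ := by
    refine (abs_le_of_sq_le_sq' ?_ (norm_nonneg _)).2
    rw [hval]
    obtain ⟨i, hi⟩ : ∃ i, r ≤ t i := by
      by_contra hcon
      push Not at hcon
      have : ∑ i, t i < ∑ _i : Fin n, r :=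
        Finset.sum_lt_sum_of_nonempty ⟨⟨0, by omega⟩, Finset.mem_univ _⟩ fun i _ => hcon i
      rw [htsum] at this
      simp [hr, hn0.ne'] at this
    by_cases h2 : t i ≤ 1 / 2
    · have := L1 i h2
      nlinarith
    · have := L3 i (by linarith)
      nlinarith [sq_nonneg (2 * r - 1)]
  refine ⟨hlower, ?_, ?_⟩
  · intro hti
    have hti' : ∀ i, t i = r := by
      intro i
      have h1 := hti i
      rw [← hTτ, hTp] at h1
      have h2 : ((t i : ℝ) : ℂ) = ((r : ℝ) : ℂ) := by rw [h1, hr]; push_cast; rfl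
      exact_mod_cast h2
    refine le_antisymm ?_ hlower
    refine (abs_le_of_sq_le_sq' ?_ hval0).2
    rw [hval]
    refine pav_norm_upper p hp hps ho hsum v _ (by nlinarith) fun i => ?_
    rw [← hti' i]
    exact pav_L2 T (p i) (star v * p i * v) (t i) hpos htr hfa (hp i) (hps i) (hqq i) (hqs i)
      (by rw [hti']; exact hninv0) (by rw [hti']; exact hninv) (hTp i) (hf1 i) (hf2 i)
  · intro h3 heq
    have h3' : (3 : ℝ) ≤ n := by exact_mod_cast h3
    have hr3 : r ≤ 1 / 3 := one_div_le_one_div_of_le (by norm_num) h3'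
    rw [heq, hval] at L1 L3
    have hle : ∀ i, t i ≤ r := by
      intro i
      by_cases h2 : t i ≤ 1 / 2
      · have := L1 i h2
        by_contra hcon
        push Not at hcon
        nlinarith
      · have := L3 i (by linarith)
        nlinarith
    have hall : ∀ i, t i = r := by
      have hs2 : ∑ i, (r - t i) = 0 := by
        rw [Finset.sum_sub_distrib, htsum]; simp [hr, hn0.ne']
      intro i
      have := (Finset.sum_eq_zero_iff_of_nonneg (fun k _ => sub_nonneg.mpr (hle k))).mp hs2 i
        (Finset.mem_univ i)
      linarith
    intro i
    rw [← hTτ, hTp, hall, hr]; push_cast; rfl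

end Main

/-- Lower bound `2√(n-1)/n` for pavings of a trace-zero
unitary `v` free from an abelian C*-subalgebra `A`, with equality exactly for
partitions into projections of trace `1/n`. -/
theorem paving_lower_bound_free_unitary
    {M : Type*} [NormedRing M] [StarRing M] [CStarRing M] [NormedAlgebra ℂ M]
    [StarModule ℂ M] [CompleteSpace M]
    (τ : M → ℂ) (hτ : IsTracialState τ) (hτf : IsFaithful τ)
    (A : StarSubalgebra ℂ M) (hclosed : IsClosed (A : Set M))
    (habelian : ∀ a ∈ A, ∀ b ∈ A, a * b = b * a)
    (v : M) (hv : IsUnitary v) (hvtrace : τ v = 0)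
    (hfree : FreeSets τ {v, star v} {a : M | a ∈ A ∧ τ a = 0})
    (n : ℕ) (hn : 2 ≤ n)
    (p : Fin n → M) (hpA : ∀ i, p i ∈ A) (hproj : ∀ i, IsProjection (p i))
    (hsum : ∑ i, p i = 1) :
    2 * Real.sqrt ((n : ℝ) - 1) / n ≤ ‖∑ i, p i * v * p i‖ ∧
    ((∀ i, τ (p i) = 1 / (n : ℂ)) →
      ‖∑ i, p i * v * p i‖ = 2 * Real.sqrt ((n : ℝ) - 1) / n) ∧
    (3 ≤ n → ‖∑ i, p i * v * p i‖ = 2 * Real.sqrt ((n : ℝ) - 1) / n →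
      ∀ i, τ (p i) = 1 / (n : ℂ)) := by
  letI : CStarAlgebra M := { (inferInstance : NormedRing M), (inferInstance : StarRing M), (inferInstance : CompleteSpace M), (inferInstance : CStarRing M), (inferInstance : NormedAlgebra ℂ M), (inferInstance : StarModule ℂ M) with }
  letI : PartialOrder M := CStarAlgebra.spectralOrder M
  haveI : StarOrderedRing M := CStarAlgebra.spectralOrderedRing M
  exact pav_core τ hτ hτf A habelian v hv hfree n hn p hpA hproj hsum
end
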